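/- arXiv:2504.09594 — 9 statements merged into one kernel-verified Lean document; each statement's English description precedes it below -/
import Mathlib

section
/- Let H and K be complex Hilbert spaces, and let A be a densely defined self-adjoint operator in H (a densely defined linear partial map equal to its adjoint). For each z ∈ ℂ with Im z ≠ 0 let R(z) be the resolvent of A, i.e. the bounded operator on H mapping H bijectively onto the domain of A with (A − z)(R(z)f) = f for all f ∈ H. Let G assign to each nonreal z a bounded operator G(z) : K → H, holomorphic on the open upper and lower half-planes, such that (i) G(z) = G(z₀) + (z − z₀)·R(z)∘G(z₀) for all nonreal z, z₀; (ii) G(z) is injective for every nonreal z; (iii) the domain of A intersects the closed subspace N = closure(range G(z₀)) only in {0} (for some, equivalently every, nonreal z₀). Let Q assign to each nonreal z a bounded operator on K, holomorphic on the open upper and lower half-planes, with Q(z)* = Q(conj z) and Q(z) − Q(z₀) = (z − z₀)·G(conj z₀)*∘G(z) for all nonreal z, z₀. Let L be a bounded self-adjoint operator on K such that Q(z) + L is boundedly invertible for every nonreal z. Then there exists a densely defined self-adjoint operator A_L in H such that for every nonreal z the operator R_L(z) = R(z) − G(z)∘(Q(z)+L)⁻¹∘G(conj z)* is injective, its range equals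 the domain of A_L, and (A_L − z)(R_L(z)f) = f for all f ∈ H. -/
open ContinuousLinearMap


theorem krein_aux {H : Type*} [NormedAddCommGroup H] [InnerProductSpace ℂ H] [CompleteSpace H]
    (J : ℂ → H →L[ℂ] H)
    (hinj : ∀ z : ℂ, z.im ≠ 0 → ∀ f, J z f = 0 → f = 0)
    (hadj : ∀ z : ℂ, z.im ≠ 0 → ∀ f g, inner ℂ (J z f) g = inner ℂ f (J (starRingEnd ℂ z) g))
    (hres : ∀ z w : ℂ, z.im ≠ 0 → w.im ≠ 0 → ∀ f, J z f - J w f = (z - w) • J z (J w f)) :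
    ∃ AL : H →ₗ.[ℂ] H, Dense (AL.domain : Set H) ∧ IsSelfAdjoint AL ∧
      ∀ z : ℂ, z.im ≠ 0 → Function.Injective (J z) ∧ Set.range (J z) = (AL.domain : Set H) ∧
        ∀ f : H, ∃ hf : J z f ∈ AL.domain, AL ⟨J z f, hf⟩ - z • (J z f) = f := by
  have hI : Complex.I.im ≠ 0 := by simp
  have key : ∀ z w : ℂ, z.im ≠ 0 → w.im ≠ 0 → ∀ x y, x = J w (y - w • x) →
      x = J z (y - z • x) := by
    intro z w hz hw x y h
    have h1 := hres z w hz hw (y - w • x)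
    rw [← h] at h1
    have h2 : y - z • x = (y - w • x) - (z - w) • x := by module
    rw [h2, map_sub, map_smul, ← h1]
    abel
  let g : Submodule ℂ (H × H) :=
    { carrier := {p | p.1 = J Complex.I (p.2 - Complex.I • p.1)}
      zero_mem' := by simp
      add_mem' := by
        intro a b ha hb
        simp only [Set.mem_ofPred_eq, Prod.fst_add, Prod.snd_add] at *
        have : a.2 + b.2 - Complex.I • (a.1 + b.1)
          = (a.2 - Complex.I • a.1) + (b.2 - Complex.I • b.1) := by module
        rw [this, map_add, ← ha, ← hb]
      smul_mem' := by
        intro c a ha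
        simp only [Set.mem_ofPred_eq, Prod.smul_fst, Prod.smul_snd] at *
        have : c • a.2 - Complex.I • c • a.1 = c • (a.2 - Complex.I • a.1) := by module
        rw [this, map_smul, ← ha] }
  have hg : ∀ z : ℂ, z.im ≠ 0 → ∀ x y, (x, y) ∈ g ↔ x = J z (y - z • x) := fun z hz x y =>
    ⟨fun h => key z _ hz hI x y h, fun h => key _ z hI hz x y h⟩
  have hgf : ∀ z : ℂ, z.im ≠ 0 → ∀ f, (J z f, f + z • J z f) ∈ g := by
    intro z hz f
    rw [hg z hz]; simp
  have hsv : ∀ x ∈ g, x.1 = 0 → x.2 = 0 := by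
    rintro ⟨x, y⟩ hxy h
    simp only at h
    subst h
    rw [hg _ hI] at hxy
    exact hinj _ hI _ (by simpa using hxy.symm)
  have hgraph : g.toLinearPMap.graph = g := Submodule.toLinearPMap_graph_eq g hsv
  have hdom : ∀ z : ℂ, z.im ≠ 0 → Set.range (J z) = (g.toLinearPMap.domain : Set H) := by
    intro z hz
    ext x
    constructor
    · rintro ⟨f, rfl⟩
      have := hgf z hz f
      rw [← hgraph] at this
      exact LinearPMap.mem_domain_of_mem_graph this
    · intro hx
      have := LinearPMap.mem_graph g.toLinearPMap ⟨x, hx⟩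
      rw [hgraph, hg z hz] at this
      exact ⟨_, this.symm⟩
  have hdense : Dense (g.toLinearPMap.domain : Set H) := by
    rw [Submodule.dense_iff_topologicalClosure_eq_top, Submodule.topologicalClosure_eq_top_iff,
      Submodule.eq_bot_iff]
    intro v hv
    rw [Submodule.mem_orthogonal] at hv
    have hc : (starRingEnd ℂ Complex.I).im ≠ 0 := by simp
    apply hinj _ hc
    rw [← inner_self_eq_zero (𝕜 := ℂ), ← hadj _ hI]
    apply hv
    rw [← SetLike.mem_coe, ← hdom _ hI]
    exact ⟨_, rfl⟩
  refine ⟨g.toLinearPMap, hdense, ?_, ?_⟩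
  · rw [LinearPMap.isSelfAdjoint_def]
    apply LinearPMap.eq_of_eq_graph
    rw [LinearPMap.adjoint_graph_eq_graph_adjoint hdense, hgraph]
    ext ⟨x, y⟩
    rw [Submodule.mem_adjoint_iff]
    have hc : (starRingEnd ℂ Complex.I).im ≠ 0 := by simp
    have e : ∀ f, inner ℂ (f + Complex.I • J Complex.I f) x - inner ℂ (J Complex.I f) y
        = inner ℂ f (x - J (starRingEnd ℂ Complex.I) (y - (starRingEnd ℂ Complex.I) • x)) := by
      intro f
      rw [inner_sub_right, ← hadj _ hI, inner_add_left, inner_smul_left, inner_sub_right,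
        inner_smul_right]
      ring
    constructor
    · intro h
      rw [hg _ hc, ← sub_eq_zero, ← inner_self_eq_zero (𝕜 := ℂ), ← e]
      exact h _ _ (hgf _ hI _)
    · intro h a b hab
      rw [hg _ hc, ← sub_eq_zero] at h
      rw [hg _ hI] at hab
      have := e (b - Complex.I • a)
      rw [← hab, h, inner_zero_right] at this
      simpa using this
  · intro z hz
    refine ⟨(injective_iff_map_eq_zero _).2 (hinj z hz), hdom z hz, fun f => ?_⟩
    have h1 := hgf z hz f
    rw [← hgraph, LinearPMap.mem_graph_iff] at h1
    obtain ⟨⟨x, hx⟩, h2, h3⟩ := h1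
    simp only at h2 h3
    subst h2
    exact ⟨hx, by rw [h3]; simp⟩

/-- **Krein's resolvent formula for singular perturbations** (Theorem 1.1).
Given a densely defined self-adjoint operator `A` in `H` with resolvent `R z`
at every nonreal `z`, a holomorphic family `G z : K →L[ℂ] H` satisfying the
resolvent-type identity, injectivity, and the trivial-intersection condition,
a holomorphic family `Q z : K →L[ℂ] K` with `Q(z)* = Q(z̄)` and the
`Q`-difference identity, and a bounded self-adjoint `L` with `Q z + L`
boundedly invertible for all nonreal `z`, there is a densely defined
self-adjoint operator `A_L` whose resolvent at every nonreal `z` is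
`R_L z = R z - G z ∘ (Q z + L)⁻¹ ∘ (G z̄)*`. -/
theorem krein_resolvent_formula
    {H K : Type*} [NormedAddCommGroup H] [InnerProductSpace ℂ H] [CompleteSpace H]
    [NormedAddCommGroup K] [InnerProductSpace ℂ K] [CompleteSpace K]
    (A : H →ₗ.[ℂ] H) (hA_dense : Dense (A.domain : Set H)) (hA : IsSelfAdjoint A)
    (R : ℂ → H →L[ℂ] H)
    (hR : ∀ z : ℂ, z.im ≠ 0 →
      Function.Injective (R z) ∧ Set.range (R z) = (A.domain : Set H) ∧
        ∀ f : H, ∃ hf : R z f ∈ A.domain, A ⟨R z f, hf⟩ - z • (R z f) = f)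
    (G : ℂ → K →L[ℂ] H)
    (hGhol : ∀ z : ℂ, z.im ≠ 0 → DifferentiableAt ℂ G z)
    (hGres : ∀ z z₀ : ℂ, z.im ≠ 0 → z₀.im ≠ 0 →
      G z = G z₀ + (z - z₀) • (R z).comp (G z₀))
    (hGinj : ∀ z : ℂ, z.im ≠ 0 → Function.Injective (G z))
    (hGdom : ∀ z₀ : ℂ, z₀.im ≠ 0 →
      ∀ f : H, f ∈ A.domain → f ∈ closure (Set.range (G z₀)) → f = 0)
    (Q : ℂ → K →L[ℂ] K)
    (hQhol : ∀ z : ℂ, z.im ≠ 0 → DifferentiableAt ℂ Q z)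
    (hQadj : ∀ z : ℂ, z.im ≠ 0 → adjoint (Q z) = Q (starRingEnd ℂ z))
    (hQres : ∀ z z₀ : ℂ, z.im ≠ 0 → z₀.im ≠ 0 →
      Q z - Q z₀ = (z - z₀) • (adjoint (G (starRingEnd ℂ z₀))).comp (G z))
    (L : K →L[ℂ] K) (hL : IsSelfAdjoint L)
    (hinv : ∀ z : ℂ, z.im ≠ 0 → IsUnit (Q z + L)) :
    ∃ AL : H →ₗ.[ℂ] H, Dense (AL.domain : Set H) ∧ IsSelfAdjoint AL ∧
      ∀ z : ℂ, z.im ≠ 0 →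
        Function.Injective
          (R z - (G z).comp ((Ring.inverse (Q z + L)).comp
            (adjoint (G (starRingEnd ℂ z))))) ∧
        Set.range
          (R z - (G z).comp ((Ring.inverse (Q z + L)).comp
            (adjoint (G (starRingEnd ℂ z))))) = (AL.domain : Set H) ∧
        ∀ f : H,
          ∃ hf : (R z - (G z).comp ((Ring.inverse (Q z + L)).comp
              (adjoint (G (starRingEnd ℂ z))))) f ∈ AL.domain,
            AL ⟨(R z - (G z).comp ((Ring.inverse (Q z + L)).comp
                (adjoint (G (starRingEnd ℂ z))))) f, hf⟩ -
              z • ((R z - (G z).comp ((Ring.inverse (Q z + L)).comp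
                (adjoint (G (starRingEnd ℂ z))))) f) = f := by
  have hc : ∀ z : ℂ, z.im ≠ 0 → (starRingEnd ℂ z).im ≠ 0 := fun z hz => by simpa using hz
  have hfa : ∀ x y : A.domain, inner ℂ (A x) (y : H) = inner ℂ (x : H) (A y) := by
    have := LinearPMap.adjoint_isFormalAdjoint hA_dense
    rw [LinearPMap.isSelfAdjoint_def.1 hA] at this
    exact this
  have hRadj : ∀ z : ℂ, z.im ≠ 0 → ∀ f g,
      inner ℂ (R z f) g = inner ℂ f (R (starRingEnd ℂ z) g) := by
    intro z hz f g
    obtain ⟨h1, h2⟩ := (hR z hz).2.2 f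
    obtain ⟨h3, h4⟩ := (hR _ (hc z hz)).2.2 g
    have h5 := hfa ⟨_, h1⟩ ⟨_, h3⟩
    simp only at h5
    conv_lhs => rw [← h4]
    conv_rhs => rw [← h2]
    rw [inner_sub_left, inner_sub_right, inner_smul_left, inner_smul_right, h5]
  have hRres : ∀ z w : ℂ, z.im ≠ 0 → w.im ≠ 0 → ∀ f,
      R z f - R w f = (z - w) • R z (R w f) := by
    intro z w hz hw f
    obtain ⟨h1, h2⟩ := (hR w hw).2.2 f
    have h3 : R w f ∈ Set.range (R z) := by rw [(hR z hz).2.1]; exact h1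
    obtain ⟨u, hu⟩ := h3
    obtain ⟨h4, h5⟩ := (hR z hz).2.2 u
    have h6 : u = f - (z - w) • R w f := by
      simp only [hu] at h5
      rw [← h5]
      nth_rewrite 4 [← h2]
      module
    nth_rewrite 1 [← hu]
    rw [h6, map_sub, map_smul]
    abel
  have hG' : ∀ z w : ℂ, z.im ≠ 0 → w.im ≠ 0 → ∀ k,
      (z - w) • R z (G w k) = G z k - G w k := by
    intro z w hz hw k
    rw [hGres z w hz hw]; simp
  have hg' : ∀ z w : ℂ, z.im ≠ 0 → w.im ≠ 0 → ∀ f,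
      (z - w) • adjoint (G (starRingEnd ℂ z)) (R w f) =
        adjoint (G (starRingEnd ℂ z)) f - adjoint (G (starRingEnd ℂ w)) f := by
    intro z w hz hw f
    apply ext_inner_left ℂ
    intro k
    rw [inner_smul_right, inner_sub_right, adjoint_inner_right, adjoint_inner_right,
      adjoint_inner_right, ← inner_sub_left, ← Complex.conj_conj w, ← hRadj _ (hc w hw),
      Complex.conj_conj, ← neg_sub (G _ k), ← hG' _ _ (hc w hw) (hc z hz), inner_neg_left,
      inner_smul_left]
    simp
    ring
  have hQ' : ∀ z w : ℂ, z.im ≠ 0 → w.im ≠ 0 → ∀ k,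
      (z - w) • adjoint (G (starRingEnd ℂ z)) (G w k) = Q z k - Q w k := by
    intro z w hz hw k
    have := congrArg (fun T : K →L[ℂ] K => T k) (hQres w z hw hz)
    simp only [sub_apply, smul_apply, comp_apply] at this
    rw [← neg_sub (Q w k), this]
    module
  have hS1 : ∀ z : ℂ, z.im ≠ 0 → ∀ k, Q z (Ring.inverse (Q z + L) k) +
      L (Ring.inverse (Q z + L) k) = k := by
    intro z hz k
    exact congrArg (fun T : K →L[ℂ] K => T k) (Ring.mul_inverse_cancel _ (hinv z hz))
  have hS2 : ∀ z : ℂ, z.im ≠ 0 → ∀ k, Ring.inverse (Q z + L) (Q z k + L k) = k := by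
    intro z hz k
    exact congrArg (fun T : K →L[ℂ] K => T k) (Ring.inverse_mul_cancel _ (hinv z hz))
  have hSadj : ∀ z : ℂ, z.im ≠ 0 → ∀ k l, inner ℂ (Ring.inverse (Q z + L) k) l =
      inner ℂ k (Ring.inverse (Q (starRingEnd ℂ z) + L) l) := by
    intro z hz k l
    conv_lhs => rw [← hS1 _ (hc z hz) l]
    conv_rhs => rw [← hS1 z hz k]
    rw [inner_add_left, inner_add_right, ← hQadj z hz, adjoint_inner_right]
    congr 1
    have hL' : adjoint L = L := hL
    have hL2 : ∀ a b, inner ℂ a (L b) = inner ℂ (L a) b := fun a b => by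
      rw [← adjoint_inner_right, hL']
    exact hL2 _ _
  apply krein_aux (fun z => R z - (G z).comp ((Ring.inverse (Q z + L)).comp
            (adjoint (G (starRingEnd ℂ z)))))
  · intro z hz f hf
    simp only [sub_apply, comp_apply] at hf
    rw [sub_eq_zero] at hf
    have h0 : R z f = 0 := by
      apply hGdom z hz _ ((hR z hz).2.2 f).1
      rw [hf]
      exact subset_closure ⟨_, rfl⟩
    exact (hR z hz).1 (by rw [h0, map_zero])
  · intro z hz f g
    simp only [sub_apply, comp_apply]
    rw [inner_sub_left, inner_sub_right, hRadj z hz, Complex.conj_conj, ← adjoint_inner_right,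
      hSadj z hz, adjoint_inner_left]
  · intro z w hz hw f
    simp only [sub_apply, comp_apply, map_sub, smul_sub]
    set S := Ring.inverse (Q z + L) with hS
    set k := Ring.inverse (Q w + L) (adjoint (G (starRingEnd ℂ w)) f) with hk
    rw [← hRres z w hz hw, hG' z w hz hw]
    simp only [← map_smul (G z), ← map_smul S]
    rw [hg' z w hz hw, hQ' z w hz hw]
    have e : S (Q z k - Q w k) = k - S (adjoint (G (starRingEnd ℂ w)) f) := by
      have h1 := hS1 w hw (adjoint (G (starRingEnd ℂ w)) f)
      have h2 := hS2 z hz k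
      rw [← hk] at h1
      rw [← hS] at h2
      rw [← h1]
      nth_rewrite 3 [← h2]
      rw [← map_sub]
      congr 1
      abel
    rw [e]
    simp only [map_sub]
    abel
end

section
/- Let H and K be complex Hilbert spaces. Suppose for each z ∈ ℂ with Im z ≠ 0 we are given bounded operators R(z) on H, G(z) : K → H, and Q(z) on K such that: R(z)* = R(conj z); the Hilbert identity R(z₁) − R(z₂) = (z₁ − z₂)·R(z₁)∘R(z₂) holds for all nonreal z₁, z₂; G(z) = G(z₀) + (z − z₀)·R(z)∘G(z₀) for all nonreal z, z₀; Q(z)* = Q(conj z); and Q(z) − Q(z₀) = (z − z₀)·G(conj z₀)*∘G(z) for all nonreal z, z₀. Let L be a bounded self-adjoint operator on K such that Q(z) + L is boundedly invertible for every nonreal z. Define R_L(z) = R(z) − G(z)∘(Q(z)+L)⁻¹∘G(conj z)*. Then R_L satisfies the Hilbert identity: R_L(z₁) − R_L(z₂) = (z₁ − z₂)·R_L(z₁)∘R_L(z₂) for all nonreal z₁, z₂. -/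
open ContinuousLinearMap

/-- Resolvent-identity step in the proof of Krein's resolvent formula:
`R_L` satisfies the Hilbert identity. -/
theorem krein_hilbert_identity
    {H K : Type*} [NormedAddCommGroup H] [InnerProductSpace ℂ H] [CompleteSpace H]
    [NormedAddCommGroup K] [InnerProductSpace ℂ K] [CompleteSpace K]
    (R : ℂ → H →L[ℂ] H) (G : ℂ → K →L[ℂ] H) (Q : ℂ → K →L[ℂ] K)
    (hR : ∀ z : ℂ, z.im ≠ 0 → adjoint (R z) = R (starRingEnd ℂ z))
    (hRres : ∀ z₁ z₂ : ℂ, z₁.im ≠ 0 → z₂.im ≠ 0 →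
      R z₁ - R z₂ = (z₁ - z₂) • (R z₁).comp (R z₂))
    (hG : ∀ z z₀ : ℂ, z.im ≠ 0 → z₀.im ≠ 0 →
      G z = G z₀ + (z - z₀) • (R z).comp (G z₀))
    (hQ : ∀ z : ℂ, z.im ≠ 0 → adjoint (Q z) = Q (starRingEnd ℂ z))
    (hQres : ∀ z z₀ : ℂ, z.im ≠ 0 → z₀.im ≠ 0 →
      Q z - Q z₀ = (z - z₀) • (adjoint (G (starRingEnd ℂ z₀))).comp (G z))
    (L : K →L[ℂ] K) (hL : IsSelfAdjoint L)
    (hinv : ∀ z : ℂ, z.im ≠ 0 → IsUnit (Q z + L))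
    (RL : ℂ → H →L[ℂ] H)
    (hRL : ∀ z : ℂ, z.im ≠ 0 →
      RL z = R z - (G z).comp ((Ring.inverse (Q z + L)).comp
        (adjoint (G (starRingEnd ℂ z))))) :
    ∀ z₁ z₂ : ℂ, z₁.im ≠ 0 → z₂.im ≠ 0 →
      RL z₁ - RL z₂ = (z₁ - z₂) • (RL z₁).comp (RL z₂) := by
  intro a b ha hb
  have hca : (starRingEnd ℂ a).im ≠ 0 := by simpa using ha
  have hcb : (starRingEnd ℂ b).im ≠ 0 := by simpa using hb
  have h0 : ∀ x, (a - b) • R a (R b x) = R a x - R b x := fun x => by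
    have := congrArg (fun T : H →L[ℂ] H => T x) (hRres a b ha hb)
    simpa using this.symm
  have h1 : ∀ k, (a - b) • R a (G b k) = G a k - G b k := fun k => by
    have := congrArg (fun T : K →L[ℂ] H => T k) (hG a b ha hb)
    simp only [ContinuousLinearMap.add_apply, ContinuousLinearMap.smul_apply,
      ContinuousLinearMap.comp_apply] at this
    rw [this]; abel
  have h2 : ∀ x, (a - b) • adjoint (G (starRingEnd ℂ a)) (R b x)
      = adjoint (G (starRingEnd ℂ a)) x - adjoint (G (starRingEnd ℂ b)) x := fun x => by
    have e := congrArg (fun T : K →L[ℂ] H => adjoint T x)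
      (hG (starRingEnd ℂ b) (starRingEnd ℂ a) hcb hca)
    simp only [map_add, map_smulₛₗ, adjoint_comp, hR _ hcb, map_sub, Complex.conj_conj,
      ContinuousLinearMap.add_apply, ContinuousLinearMap.smul_apply,
      ContinuousLinearMap.comp_apply] at e
    rw [e]; module
  have h3 : ∀ k, (a - b) • adjoint (G (starRingEnd ℂ a)) (G b k) = Q a k - Q b k := fun k => by
    have e := congrArg (fun T : K →L[ℂ] K => T k) (hQres b a hb ha)
    simp only [ContinuousLinearMap.sub_apply, ContinuousLinearMap.smul_apply,
      ContinuousLinearMap.comp_apply] at e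
    rw [← neg_sub (Q b k), e]; module
  have h4 : ∀ y, Ring.inverse (Q a + L) (Q a y + L y) = y := fun y => by
    have e := congrArg (fun T : K →L[ℂ] K => T y) (Ring.inverse_mul_cancel _ (hinv a ha))
    simpa using e
  have h5 : ∀ y, Q b (Ring.inverse (Q b + L) y) + L (Ring.inverse (Q b + L) y) = y := fun y => by
    have e := congrArg (fun T : K →L[ℂ] K => T y) (Ring.mul_inverse_cancel _ (hinv b hb))
    simpa using e
  ext x
  rw [hRL a ha, hRL b hb]
  simp only [ContinuousLinearMap.sub_apply, ContinuousLinearMap.smul_apply,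
      ContinuousLinearMap.comp_apply, map_sub, smul_sub, h0, h1]
  simp only [← map_smul, h2, h3]
  generalize adjoint (G (starRingEnd ℂ b)) x = y
  have h6 : Q a (Ring.inverse (Q b + L) y) - Q b (Ring.inverse (Q b + L) y)
    = (Q a (Ring.inverse (Q b + L) y) + L (Ring.inverse (Q b + L) y)) - y := by
    rw [eq_sub_of_add_eq (h5 y)]
    abel
  rw [h6]
  simp only [map_sub, h4]
  abel
end

section
/- Let N be a complex Hilbert space, let g₁, …, g_N be linearly independent vectors in N, let Υ be the N×N Gram matrix with entries Υ_{nm} = ⟨g_n, g_m⟩, and let Λ be any Hermitian N×N complex matrix such that the matrix Λ + iΥ is invertible. Then the bounded linear operator Ω on N defined by Ω f = f − 2i · Σ_{n,m=1}^{N} ((Λ + iΥ)⁻¹)_{nm} ⟨f, g_n⟩ g_m is unitary (Ω*Ω = ΩΩ* = I). -/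
open ContinuousLinearMap
open scoped InnerProductSpace

noncomputable def gpT {E : Type*} [NormedAddCommGroup E] [InnerProductSpace ℂ E]
    {N : ℕ} (g : Fin N → E) (M : Matrix (Fin N) (Fin N) ℂ) : E →L[ℂ] E :=
  ∑ n, ∑ m, M n m • (innerSL ℂ (g n)).smulRight (g m)

lemma gpT_apply {E : Type*} [NormedAddCommGroup E] [InnerProductSpace ℂ E]
    {N : ℕ} (g : Fin N → E) (M : Matrix (Fin N) (Fin N) ℂ) (f : E) :
    gpT g M f = ∑ n, ∑ m, M n m • (⟪g n, f⟫_ℂ • g m) := by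
  simp [gpT]

lemma gpT_sub {E : Type*} [NormedAddCommGroup E] [InnerProductSpace ℂ E]
    {N : ℕ} (g : Fin N → E) (M P : Matrix (Fin N) (Fin N) ℂ) :
    gpT g (M - P) = gpT g M - gpT g P := by
  simp [gpT, sub_smul]

lemma gpT_smul {E : Type*} [NormedAddCommGroup E] [InnerProductSpace ℂ E]
    {N : ℕ} (g : Fin N → E) (c : ℂ) (M : Matrix (Fin N) (Fin N) ℂ) :
    gpT g (c • M) = c • gpT g M := by
  simp [gpT, Finset.smul_sum, smul_smul]

lemma gpT_adjoint {E : Type*} [NormedAddCommGroup E] [InnerProductSpace ℂ E] [CompleteSpace E]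
    {N : ℕ} (g : Fin N → E) (M : Matrix (Fin N) (Fin N) ℂ) :
    adjoint (gpT g M) = gpT g M.conjTranspose := by
  symm
  rw [ContinuousLinearMap.eq_adjoint_iff]
  intro x y
  simp only [gpT_apply, sum_inner, inner_sum, inner_smul_left, inner_smul_right,
    Matrix.conjTranspose_apply, inner_conj_symm]
  rw [Finset.sum_comm]
  refine Finset.sum_congr rfl fun n _ => Finset.sum_congr rfl fun m _ => ?_
  simp only [starRingEnd_apply, star_star]
  ring

lemma gpT_mul {E : Type*} [NormedAddCommGroup E] [InnerProductSpace ℂ E]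
    {N : ℕ} (g : Fin N → E) (Υ : Matrix (Fin N) (Fin N) ℂ)
    (hΥ : ∀ n m, Υ n m = ⟪g m, g n⟫_ℂ) (M P : Matrix (Fin N) (Fin N) ℂ) :
    gpT g M * gpT g P = gpT g (P * Υ * M) := by
  ext f
  have h : ∀ n, ⟪g n, gpT g P f⟫_ℂ = ∑ k, (P * Υ) k n * ⟪g k, f⟫_ℂ := by
    intro n
    simp only [gpT_apply, inner_sum, inner_smul_right, Matrix.mul_apply, Finset.sum_mul, hΥ]
    refine Finset.sum_congr rfl fun n _ => Finset.sum_congr rfl fun m _ => ?_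
    ring
  rw [ContinuousLinearMap.mul_apply, gpT_apply g M, gpT_apply g (P * Υ * M)]
  simp only [h, Matrix.mul_apply (M := P * Υ), Finset.sum_mul, Finset.sum_smul, Finset.smul_sum, smul_smul]
  rw [Finset.sum_comm' (t' := Finset.univ) (s' := fun _ => Finset.univ) (by simp)]
  rw [Finset.sum_congr rfl fun m _ => Finset.sum_comm]
  rw [Finset.sum_comm]
  refine Finset.sum_congr rfl fun k _ => Finset.sum_congr rfl fun m _ =>
    Finset.sum_congr rfl fun n _ => ?_
  congr 1
  ring

/-- Proposition 3.2: if `g₁, …, g_N` are linearly independent vectors of a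
complex Hilbert space `E`, `Υ` is their Gram matrix (`Υ n m = ⟨g n, g m⟩`,
linear in the first argument), and `Λ` is a Hermitian matrix such that
`Λ + iΥ` is invertible, then
`Ω f = f - 2i ∑ n m, ((Λ + iΥ)⁻¹)_{n m} ⟨f, g n⟩ g m` is unitary. -/
theorem gram_perturbation_unitary
    {E : Type*} [NormedAddCommGroup E] [InnerProductSpace ℂ E] [CompleteSpace E]
    {N : ℕ} (g : Fin N → E) (hg : LinearIndependent ℂ g)
    (Υ : Matrix (Fin N) (Fin N) ℂ)
    (hΥ : ∀ n m, Υ n m = ⟪g m, g n⟫_ℂ)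
    (Λ : Matrix (Fin N) (Fin N) ℂ) (hΛ : Λ.IsHermitian)
    (hunit : IsUnit (Λ + Complex.I • Υ))
    (Ω : E →L[ℂ] E)
    (hΩ : ∀ f : E, Ω f =
      f - (2 * Complex.I) •
        ∑ n : Fin N, ∑ m : Fin N,
          ((Λ + Complex.I • Υ)⁻¹ n m) • (⟪g n, f⟫_ℂ • g m)) :
    (adjoint Ω).comp Ω = ContinuousLinearMap.id ℂ E ∧
      Ω.comp (adjoint Ω) = ContinuousLinearMap.id ℂ E := by
  set A := Λ + Complex.I • Υ with hA
  set B := A⁻¹ with hB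
  have hdet : IsUnit A.det := (Matrix.isUnit_iff_isUnit_det _).1 hunit
  have hAB : A * B = 1 := Matrix.mul_nonsing_inv _ hdet
  have hBA : B * A = 1 := Matrix.nonsing_inv_mul _ hdet
  have hAB' : B.conjTranspose * A.conjTranspose = 1 := by
    rw [← Matrix.conjTranspose_mul, hAB, Matrix.conjTranspose_one]
  have hBA' : A.conjTranspose * B.conjTranspose = 1 := by
    rw [← Matrix.conjTranspose_mul, hBA, Matrix.conjTranspose_one]
  have hΥh : Υ.conjTranspose = Υ := by
    ext n m
    simp [Matrix.conjTranspose_apply, hΥ]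
  have hAs : A - A.conjTranspose = (2 * Complex.I) • Υ := by
    rw [hA, Matrix.conjTranspose_add, Matrix.conjTranspose_smul, hΥh, hΛ.eq]
    ext n m
    simp
    ring
  have h1 : (2 * Complex.I) • (B * Υ * B.conjTranspose) = B.conjTranspose - B := by
    rw [← Matrix.smul_mul, ← Matrix.mul_smul, ← hAs, mul_sub, sub_mul, hBA, one_mul,
      mul_assoc, hBA', mul_one]
  have h2 : (2 * Complex.I) • (B.conjTranspose * Υ * B) = B.conjTranspose - B := by
    rw [← Matrix.smul_mul, ← Matrix.mul_smul, ← hAs, mul_sub, sub_mul, hAB', one_mul,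
      mul_assoc, hAB, mul_one]
  have e1 := congrArg (gpT g) h1
  have e2 := congrArg (gpT g) h2
  rw [gpT_smul, gpT_sub, ← gpT_mul g Υ hΥ] at e1 e2
  have hΩ' : Ω = 1 - (2 * Complex.I) • gpT g B := by
    ext f
    rw [hΩ]
    simp [gpT_apply]
  have hΩa : adjoint Ω = 1 + (2 * Complex.I) • gpT g B.conjTranspose := by
    rw [hΩ', ← ContinuousLinearMap.star_eq_adjoint, star_sub, star_one, star_smul,
      ContinuousLinearMap.star_eq_adjoint, gpT_adjoint]
    simp
  have key : ∀ (X Y Z : E →L[ℂ] E), (2 * Complex.I) • Z = Y - X →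
      1 - (2 * Complex.I) • X + (2 * Complex.I) • Y
        - (2 * Complex.I) • (2 * Complex.I) • Z = 1 := by
    intro X Y Z h
    rw [h, smul_sub]
    abel
  rw [hΩa, hΩ']
  change (1 + (2 * Complex.I) • gpT g B.conjTranspose) * (1 - (2 * Complex.I) • gpT g B) = 1 ∧
    (1 - (2 * Complex.I) • gpT g B) * (1 + (2 * Complex.I) • gpT g B.conjTranspose) = 1
  constructor
  · refine Eq.trans ?_ (key _ _ _ e1)
    rw [add_mul, mul_sub, mul_sub, one_mul, one_mul, mul_one,
      smul_mul_smul_comm]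
    module
  · refine Eq.trans ?_ (key _ _ _ e2)
    rw [sub_mul, mul_add, mul_add, one_mul, one_mul, mul_one,
      smul_mul_smul_comm]
    module
end

section
/- Let K and N be complex Hilbert spaces, G : K → N a bounded linear operator, and Λ a bounded self-adjoint operator on K such that Λ + i·G*∘G is boundedly invertible with inverse Γ. Then the bounded operator Ω = I − 2i·G∘Γ∘G* on N is unitary, i.e., Ω*Ω = ΩΩ* = I. -/
open ContinuousLinearMap

/-- Operator-theoretic form of Proposition 3.2: if `G : K →L[ℂ] N` is bounded,
`Λ` is bounded self-adjoint on `K`, and `Λ + i·G*G` is boundedly invertible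
with inverse `Γ`, then `Ω = I - 2i·G Γ G*` is unitary on `N`. -/
theorem operator_perturbation_unitary
    {K N : Type*} [NormedAddCommGroup K] [InnerProductSpace ℂ K] [CompleteSpace K]
    [NormedAddCommGroup N] [InnerProductSpace ℂ N] [CompleteSpace N]
    (G : K →L[ℂ] N) (Λ : K →L[ℂ] K) (hΛ : IsSelfAdjoint Λ)
    (Γ : K →L[ℂ] K)
    (hΓ₁ : (Λ + Complex.I • ((adjoint G).comp G)).comp Γ = ContinuousLinearMap.id ℂ K)
    (hΓ₂ : Γ.comp (Λ + Complex.I • ((adjoint G).comp G)) = ContinuousLinearMap.id ℂ K)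
    (Ω : N →L[ℂ] N)
    (hΩ : Ω = ContinuousLinearMap.id ℂ N -
      (2 * Complex.I) • (G.comp (Γ.comp (adjoint G)))) :
    (adjoint Ω).comp Ω = ContinuousLinearMap.id ℂ N ∧
      Ω.comp (adjoint Ω) = ContinuousLinearMap.id ℂ N := by
  have hΛ' : adjoint Λ = Λ := hΛ
  have hA : adjoint (Λ + Complex.I • ((adjoint G).comp G)) =
      Λ - Complex.I • ((adjoint G).comp G) := by
    rw [map_add, hΛ', LinearIsometryEquiv.map_smulₛₗ, adjoint_comp, adjoint_adjoint]
    simp [sub_eq_add_neg]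
  have h1 := congrArg adjoint hΓ₁
  have h2 := congrArg adjoint hΓ₂
  rw [adjoint_comp, hA, adjoint_id] at h1 h2
  have hΩ' : adjoint Ω = ContinuousLinearMap.id ℂ N +
      (2 * Complex.I) • (G.comp ((adjoint Γ).comp (adjoint G))) := by
    rw [hΩ, map_sub, LinearIsometryEquiv.map_smulₛₗ, adjoint_comp, adjoint_comp, adjoint_adjoint,
      adjoint_id]
    have h2c : (starRingEnd ℂ) 2 = 2 := Complex.conj_ofNat 2
    simp [sub_eq_add_neg, ContinuousLinearMap.comp_assoc, h2c]
  generalize adjoint Γ = D at *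
  have e1 : ∀ x, D x = Γ x + (2 * Complex.I) • D (adjoint G (G (Γ x))) := by
    intro x
    have a := DFunLike.congr_fun hΓ₁ x
    have b := DFunLike.congr_fun h1 (Γ x)
    simp only [ContinuousLinearMap.comp_apply, add_apply, sub_apply, smul_apply, id_apply, map_sub,
      map_smul] at a b
    have c := congrArg D a
    simp only [map_add, map_smul] at c
    rw [← c]
    nth_rewrite 3 [← b]
    module
  have e2 : ∀ x, Γ x = D x - (2 * Complex.I) • Γ (adjoint G (G (D x))) := by
    intro x
    have a := DFunLike.congr_fun h2 x
    have b := DFunLike.congr_fun hΓ₂ (D x)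
    simp only [ContinuousLinearMap.comp_apply, add_apply, sub_apply, smul_apply, id_apply, map_add,
      map_smul] at a b
    have c := congrArg Γ a
    simp only [map_sub, map_smul] at c
    rw [← c]
    nth_rewrite 3 [← b]
    module
  rw [hΩ', hΩ]
  constructor
  · ext x
    have e := congrArg G (e1 (adjoint G x))
    simp only [ContinuousLinearMap.comp_apply, add_apply, sub_apply, smul_apply, id_apply, map_add,
      map_sub, map_smul] at e ⊢
    rw [e]
    module
  · ext x
    have e := congrArg G (e2 (adjoint G x))
    simp only [ContinuousLinearMap.comp_apply, add_apply, sub_apply, smul_apply, id_apply, map_add,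
      map_sub, map_smul] at e ⊢
    rw [e]
    module
end

section
/- Let x₁, …, x_N be pairwise distinct points of the plane ℝ² and let a > 0. Then the continuous functions w₁, …, w_N : [0, 2π] → ℂ defined by w_j(θ) = exp(i·a·⟨(cos θ, sin θ), x_j⟩) (equivalently, in polar coordinates x_j = (r_j, φ_j), w_j(θ) = exp(i·a·r_j·cos(θ − φ_j))) are linearly independent over ℂ. -/
open scoped Real

lemma pe_extend {N : ℕ} (x : Fin N → ℝ × ℝ) (a : ℝ) (c : Fin N → ℂ)
    (h : ∀ θ ∈ Set.Icc (0 : ℝ) (2 * π), ∑ j, c j * Complex.exp (Complex.I *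
          ((a * (Real.cos θ * (x j).1 + Real.sin θ * (x j).2) : ℝ) : ℂ)) = 0) (z : ℂ) :
    ∑ j, c j * Complex.exp (Complex.I *
          (a * (Complex.cos z * (x j).1 + Complex.sin z * (x j).2))) = 0 := by
  have hd : Differentiable ℂ (fun z : ℂ => ∑ j, c j * Complex.exp (Complex.I *
          (a * (Complex.cos z * (x j).1 + Complex.sin z * (x j).2)))) := by
    fun_prop
  have h1 : AnalyticOnNhd ℂ (fun z : ℂ => ∑ j, c j * Complex.exp (Complex.I *
          (a * (Complex.cos z * (x j).1 + Complex.sin z * (x j).2)))) Set.univ :=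
    fun z _ => hd.analyticAt z
  have h2 : AnalyticOnNhd ℂ (fun _ : ℂ => (0 : ℂ)) Set.univ := fun z _ => analyticAt_const
  have ht : Filter.Tendsto (fun r : ℝ => (r : ℂ)) (nhdsWithin 1 {1}ᶜ) (nhdsWithin ((1 : ℝ) : ℂ) {((1 : ℝ) : ℂ)}ᶜ) := by
    apply Complex.continuous_ofReal.continuousWithinAt.tendsto_nhdsWithin
    intro r hr
    simpa using hr
  have he : ∀ᶠ r : ℝ in nhdsWithin 1 {1}ᶜ, ∑ j, c j * Complex.exp (Complex.I *
          (a * (Complex.cos r * (x j).1 + Complex.sin r * (x j).2))) = 0 := by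
    have : Set.Icc (0 : ℝ) (2 * π) ∈ nhds (1 : ℝ) :=
      Icc_mem_nhds (by norm_num) (by linarith [Real.pi_gt_three])
    filter_upwards [mem_nhdsWithin_of_mem_nhds this] with r hr
    rw [← h r hr]
    push_cast
    rfl
  have := h1.eq_of_frequently_eq h2 (ht.frequently he.frequently)
  exact congrFun this z

lemma pe_re (a α t p q : ℝ) :
    (Complex.I * (a * (Complex.cos (α + t * Complex.I) * p
      + Complex.sin (α + t * Complex.I) * q))).re
      = a * Real.sinh t * (Real.sin α * p - Real.cos α * q) := by
  rw [Complex.cos_add_mul_I, Complex.sin_add_mul_I]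
  simp only [← Complex.ofReal_cos, ← Complex.ofReal_sin, ← Complex.ofReal_cosh,
    ← Complex.ofReal_sinh]
  simp [-Complex.ofReal_cos, -Complex.ofReal_sin, -Complex.ofReal_cosh,
    -Complex.ofReal_sinh]
  ring

/-- The Proposition of Section 4: for pairwise distinct points
`x₁, …, x_N` of the plane `ℝ²` and `a > 0`, the continuous functions
`w_j(θ) = exp(i·a·((cos θ)·(x_j)₁ + (sin θ)·(x_j)₂))` on `[0, 2π]`
are linearly independent over `ℂ`. -/
theorem plane_exponentials_linearIndependent
    {N : ℕ} (x : Fin N → ℝ × ℝ) (hx : Function.Injective x)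
    (a : ℝ) (ha : 0 < a) :
    LinearIndependent ℂ
      (fun j : Fin N => fun θ : Set.Icc (0 : ℝ) (2 * π) =>
        Complex.exp (Complex.I *
          ((a * (Real.cos θ * (x j).1 + Real.sin θ * (x j).2) : ℝ) : ℂ))) := by
  rw [Fintype.linearIndependent_iff]
  intro c hc
  by_contra! hne
  obtain ⟨i₀, hi₀⟩ := hne
  have hF := pe_extend x a c (fun θ hθ => by
    have := congrFun hc ⟨θ, hθ⟩
    simpa only [Finset.sum_apply, Pi.smul_apply, smul_eq_mul, Pi.zero_apply] using this)
  obtain ⟨k, hk, hmax⟩ := (Finset.univ.filter (fun j => c j ≠ 0)).exists_max_image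
    (fun j => (x j).1 ^ 2 + (x j).2 ^ 2) ⟨i₀, by simpa using hi₀⟩
  simp only [Finset.mem_filter, Finset.mem_univ, true_and] at hk hmax
  obtain ⟨ρ, α, hρ, h1, h2⟩ : ∃ ρ α : ℝ, 0 ≤ ρ ∧ (x k).1 = ρ * Real.sin α ∧
      (x k).2 = - (ρ * Real.cos α) := by
    let w : ℂ := ⟨(x k).1, (x k).2⟩
    refine ⟨‖w‖, w.arg + π / 2, norm_nonneg _, ?_, ?_⟩
    · rw [Real.sin_add_pi_div_two, Complex.norm_mul_cos_arg]
    · rw [Real.cos_add_pi_div_two, mul_neg, neg_neg, Complex.norm_mul_sin_arg]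
  have hδ : ∀ j, c j ≠ 0 → j ≠ k → Real.sin α * ((x j).1 - (x k).1)
      - Real.cos α * ((x j).2 - (x k).2) < 0 := by
    intro j hj hjk
    have hm := hmax j hj
    have hpos : 0 < ((x j).1 - (x k).1) ^ 2 + ((x j).2 - (x k).2) ^ 2 := by
      by_contra! hle
      apply hjk
      apply hx
      apply Prod.ext <;> nlinarith [sq_nonneg ((x j).1 - (x k).1), sq_nonneg ((x j).2 - (x k).2)]
    have : ρ * (Real.sin α * ((x j).1 - (x k).1)
      - Real.cos α * ((x j).2 - (x k).2)) < 0 := by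
      have e : ρ * (Real.sin α * ((x j).1 - (x k).1) - Real.cos α * ((x j).2 - (x k).2))
        = (x k).1 * ((x j).1 - (x k).1) + (x k).2 * ((x j).2 - (x k).2) := by
        linear_combination (-((x j).1 - (x k).1)) * h1 - ((x j).2 - (x k).2) * h2
      rw [e]
      nlinarith
    by_contra! hle
    exact absurd (mul_nonneg hρ hle) (not_le.mpr this)
  let E : Fin N → ℝ → ℂ := fun j t => Complex.I *
    (a * (Complex.cos (α + t * Complex.I) * (x j).1 + Complex.sin (α + t * Complex.I) * (x j).2))
  have hz : ∀ t : ℝ, ∑ j, c j * Complex.exp (E j t - E k t) = 0 := by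
    intro t
    have := hF (α + t * Complex.I)
    simp only [Complex.exp_sub, ← mul_div_assoc]
    rw [← Finset.sum_div]
    simp only [E]
    rw [this, zero_div]
  have hlim : Filter.Tendsto (fun t : ℝ => ∑ j, c j * Complex.exp (E j t - E k t)) Filter.atTop
      (nhds (∑ j, if j = k then c k else 0)) := by
    apply tendsto_finsetSum
    intro j _
    by_cases hjk : j = k
    · subst hjk
      simp
    rw [if_neg hjk]
    by_cases hj : c j = 0
    · simp [hj]
    rw [← mul_zero (c j)]
    apply Filter.Tendsto.const_mul
    rw [tendsto_zero_iff_norm_tendsto_zero]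
    have e : ∀ t, ‖Complex.exp (E j t - E k t)‖ = Real.exp (Real.sinh t *
      (a * (Real.sin α * ((x j).1 - (x k).1) - Real.cos α * ((x j).2 - (x k).2)))) := by
      intro t
      rw [Complex.norm_exp, Complex.sub_re]
      simp only [E]
      rw [pe_re, pe_re]
      congr 1
      ring
    simp only [e]
    apply Real.tendsto_exp_atBot.comp
    apply Filter.Tendsto.atTop_mul_const_of_neg (mul_neg_of_pos_of_neg ha (hδ j hj hjk))
    apply Filter.tendsto_atTop_mono' _ _ Filter.tendsto_id
    filter_upwards [Filter.eventually_ge_atTop 0] with t ht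
    exact Real.self_le_sinh_iff.mpr ht
  simp only [hz, Finset.sum_ite_eq', Finset.mem_univ, if_true] at hlim
  exact hk (tendsto_nhds_unique hlim tendsto_const_nhds)
end

section
/- Let x₁, …, x_N be pairwise distinct points of ℝ³ and let a > 0. Then the continuous functions e₁, …, e_N on the unit sphere S² ⊂ ℝ³ defined by e_j(n) = exp(−i·a·⟨n, x_j⟩) are linearly independent over ℂ; in particular they are linearly independent as elements of L²(S²). -/
open scoped InnerProductSpace
open MeasureTheory


theorem aux_growth {N : ℕ} (β : Fin N → ℝ) (hβ : Function.Injective β)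
    (c : Fin N → ℂ) (w : Fin N → ℝ → ℂ) (hw : ∀ j s, ‖w j s‖ = 1)
    (h : ∀ s : ℝ, ∑ j, c j * (w j s * (Real.exp (β j * s) : ℂ)) = 0) : c = 0 := by
  classical
  by_contra hc
  obtain ⟨j0, hj0⟩ := Function.ne_iff.mp hc
  obtain ⟨k, hk, hmax⟩ := Finset.exists_max_image (Finset.univ.filter fun j => c j ≠ 0) β
    ⟨j0, by simpa using hj0⟩
  have hk' : c k ≠ 0 := by simpa using hk
  have key : ∀ s : ℝ, ‖c k‖ ≤ ∑ j ∈ Finset.univ.erase k, ‖c j‖ * Real.exp ((β j - β k) * s) := by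
    intro s
    have h1 := h s
    rw [← Finset.add_sum_erase _ _ (Finset.mem_univ k)] at h1
    have h2 := congrArg norm (eq_neg_of_add_eq_zero_left h1)
    rw [norm_neg, norm_mul, norm_mul, hw, one_mul, Complex.norm_real, Real.norm_eq_abs,
      Real.abs_exp] at h2
    have h3 : ‖c k‖ * Real.exp (β k * s) ≤
        ∑ j ∈ Finset.univ.erase k, ‖c j‖ * Real.exp (β j * s) := by
      rw [h2]
      refine (norm_sum_le _ _).trans (Finset.sum_le_sum fun j _ => ?_)
      rw [norm_mul, norm_mul, hw, one_mul, Complex.norm_real, Real.norm_eq_abs, Real.abs_exp]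
    have h4 : ∑ j ∈ Finset.univ.erase k, ‖c j‖ * Real.exp ((β j - β k) * s) =
        (∑ j ∈ Finset.univ.erase k, ‖c j‖ * Real.exp (β j * s)) * Real.exp (-(β k * s)) := by
      rw [Finset.sum_mul]
      refine Finset.sum_congr rfl fun j _ => ?_
      rw [mul_assoc, ← Real.exp_add]
      ring_nf
    rw [h4]
    calc ‖c k‖ = ‖c k‖ * Real.exp (β k * s) * Real.exp (-(β k * s)) := by
          rw [mul_assoc, ← Real.exp_add]; simp
      _ ≤ _ := by gcongr
  have lim : Filter.Tendsto
      (fun s : ℝ => ∑ j ∈ Finset.univ.erase k, ‖c j‖ * Real.exp ((β j - β k) * s))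
      Filter.atTop (nhds 0) := by
    rw [← Finset.sum_const_zero (s := Finset.univ.erase k)]
    refine tendsto_finsetSum _ fun j hj => ?_
    by_cases hcj : c j = 0
    · simp [hcj]
    · have hlt : β j - β k < 0 := by
        have h1 := hmax j (by simpa using hcj)
        have h2 : β j ≠ β k := fun e => (Finset.ne_of_mem_erase hj) (hβ e)
        have := lt_of_le_of_ne h1 h2
        linarith
      have := (Real.tendsto_exp_atBot.comp
        (Filter.tendsto_id.const_mul_atTop_of_neg hlt)).const_mul ‖c j‖
      simpa using this
  have := ge_of_tendsto' lim key
  exact hk' (by simpa using this)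

theorem aux_complex {N : ℕ} (α β : Fin N → ℝ) (hβ : Function.Injective β)
    (c : Fin N → ℂ) (a : ℝ) (ha : 0 < a)
    (h : ∀ θ : ℝ, ∑ j, c j * Complex.exp
      (-Complex.I * ((a * (Real.cos θ * α j + Real.sin θ * β j) : ℝ) : ℂ)) = 0) : c = 0 := by
  let g : ℂ → ℂ := fun z => ∑ j, c j * Complex.exp
      (-Complex.I * (a * (Complex.cos z * α j + Complex.sin z * β j)))
  have hg : Differentiable ℂ g := by
    unfold g
    fun_prop
  have hreal : ∀ θ : ℝ, g θ = 0 := by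
    intro θ
    rw [← h θ]
    simp [g]
  have hzero : ∀ z, g z = 0 := by
    have hA : AnalyticOnNhd ℂ g Set.univ := fun z _ => hg.analyticAt z
    have hB : AnalyticOnNhd ℂ (fun _ : ℂ => (0 : ℂ)) Set.univ := fun z _ => analyticAt_const
    have hfr : ∃ᶠ z in nhdsWithin (0 : ℂ) {0}ᶜ, g z = 0 := by
      have ht : Filter.Tendsto (fun t : ℝ => (t : ℂ)) (nhdsWithin (0 : ℝ) {0}ᶜ)
          (nhdsWithin (0 : ℂ) {0}ᶜ) := by
        refine tendsto_nhdsWithin_iff.mpr ⟨?_, ?_⟩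
        · have := Complex.continuous_ofReal.tendsto 0
          simp only [Complex.ofReal_zero] at this
          exact this.mono_left nhdsWithin_le_nhds
        · filter_upwards [self_mem_nhdsWithin] with t ht
          simpa using ht
      exact ht.frequently (Filter.Frequently.of_forall hreal)
    have := hA.eq_of_frequently_eq hB hfr
    exact fun z => congrFun this z
  refine aux_growth (fun j => a * β j) (fun i j hij => hβ (mul_left_cancel₀ ha.ne' hij)) c
    (fun j s => Complex.exp (((-(a * (Real.cosh (Real.arsinh s) * α j)) : ℝ) : ℂ) * Complex.I))
    (fun j s => Complex.norm_exp_ofReal_mul_I _) fun s => ?_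
  rw [← hzero ((Real.arsinh s : ℝ) * Complex.I)]
  refine Finset.sum_congr rfl fun j _ => ?_
  rw [Complex.cos_mul_I, Complex.sin_mul_I, ← Complex.ofReal_cosh, ← Complex.ofReal_sinh,
    Real.sinh_arsinh, Complex.ofReal_exp, ← Complex.exp_add]
  congr 2
  push_cast
  linear_combination ((a : ℂ) * s * β j) * Complex.I_sq

theorem aux_frame {N : ℕ} [Nonempty (Fin N)] (x : Fin N → EuclideanSpace ℝ (Fin 3))
    (hx : Function.Injective x) :
    ∃ u v : EuclideanSpace ℝ (Fin 3), ‖u‖ = 1 ∧ ‖v‖ = 1 ∧ ⟪u, v⟫_ℝ = 0 ∧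
      Function.Injective fun j => ⟪v, x j⟫_ℝ := by
  classical
  obtain ⟨e, he⟩ := exists_ne (0 : EuclideanSpace ℝ (Fin 3))
  let w : Fin N × Fin N → EuclideanSpace ℝ (Fin 3) := fun p =>
    if x p.1 - x p.2 = 0 then e else x p.1 - x p.2
  have hw : ∀ p, w p ≠ 0 := by
    intro p
    unfold w
    split_ifs with h
    · exact he
    · exact h
  obtain ⟨v, hv⟩ := Module.Dual.exists_forall_ne_zero_of_forall_exists (K := ℝ)
    (fun p => (innerSL ℝ (w p)).toLinearMap) (fun p => ⟨w p, by simpa using hw p⟩)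
  replace hv : ∀ p, ⟪w p, v⟫_ℝ ≠ 0 := fun p => by simpa using hv p
  have hv0 : v ≠ 0 := by
    rintro rfl
    obtain ⟨i⟩ := ‹Nonempty (Fin N)›
    exact hv (i, i) (inner_zero_right _)
  have hex : (Submodule.span ℝ {v})ᗮ ≠ ⊥ := by
    intro h
    rw [Submodule.orthogonal_eq_bot_iff] at h
    have h1 := finrank_span_singleton (K := ℝ) hv0
    rw [h, finrank_top] at h1
    simp at h1
  obtain ⟨u, hu, hu0⟩ := Submodule.exists_mem_ne_zero_of_ne_bot hex
  have huv : ⟪u, v⟫_ℝ = 0 := by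
    rw [real_inner_comm]
    exact Submodule.mem_orthogonal_singleton_iff_inner_right.mp hu
  refine ⟨(‖u‖⁻¹ : ℝ) • u, (‖v‖⁻¹ : ℝ) • v, norm_smul_inv_norm hu0, norm_smul_inv_norm hv0, ?_, ?_⟩
  · simp [inner_smul_left, inner_smul_right, huv]
  · intro i j hij
    by_contra hne
    have hsub : x i - x j ≠ 0 := sub_ne_zero.mpr fun e => hne (hx e)
    have h1 := hv (i, j)
    simp only [w, hsub, if_false] at h1
    simp only [real_inner_smul_left] at hij
    have h2 := mul_left_cancel₀ (inv_ne_zero (norm_ne_zero_iff.mpr hv0)) hij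
    apply h1
    rw [real_inner_comm, inner_sub_right, h2, sub_self]

theorem aux_main {N : ℕ} (x : Fin N → EuclideanSpace ℝ (Fin 3)) (hx : Function.Injective x)
    (a : ℝ) (ha : 0 < a) (c : Fin N → ℂ)
    (h : ∀ n : Metric.sphere (0 : EuclideanSpace ℝ (Fin 3)) 1,
        ∑ j : Fin N, c j *
          Complex.exp (-Complex.I * ((a * ⟪(n : EuclideanSpace ℝ (Fin 3)), x j⟫_ℝ : ℝ) : ℂ)) = 0) :
      c = 0 := by
  rcases isEmpty_or_nonempty (Fin N) with hN | hN
  · exact Subsingleton.elim _ _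
  obtain ⟨u, v, hu, hv, huv, hinj⟩ := aux_frame x hx
  refine aux_complex (fun j => ⟪u, x j⟫_ℝ) _ hinj c a ha fun θ => ?_
  have hn : ‖Real.cos θ • u + Real.sin θ • v‖ = 1 := by
    have h1 : ‖Real.cos θ • u + Real.sin θ • v‖ ^ 2 = 1 := by
      rw [norm_add_sq_real, real_inner_smul_left, real_inner_smul_right, huv, norm_smul, norm_smul,
        hu, hv, Real.norm_eq_abs, Real.norm_eq_abs, mul_one, mul_one, sq_abs, sq_abs]
      linarith [Real.sin_sq_add_cos_sq θ]
    exact (pow_eq_one_iff_of_nonneg (norm_nonneg _) two_ne_zero).mp h1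
  have := h ⟨Real.cos θ • u + Real.sin θ • v, by simpa using hn⟩
  simpa only [inner_add_left, real_inner_smul_left] using this

/-- For pairwise distinct points `x₁, …, x_N` of `ℝ³` and `a > 0`, the
continuous functions `e_j(n) = exp(-i·a·⟨n, x_j⟩)` on the unit sphere `S²`
are linearly independent over `ℂ`; in particular they are linearly
independent as elements of `L²(S²)` (no nontrivial linear combination
vanishes almost everywhere with respect to the surface measure). -/
theorem sphere_exponentials_linearIndependent
    {N : ℕ} (x : Fin N → EuclideanSpace ℝ (Fin 3)) (hx : Function.Injective x)
    (a : ℝ) (ha : 0 < a) :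
    LinearIndependent ℂ
      (fun j : Fin N =>
        fun n : Metric.sphere (0 : EuclideanSpace ℝ (Fin 3)) 1 =>
          Complex.exp (-Complex.I * ((a * ⟪(n : EuclideanSpace ℝ (Fin 3)), x j⟫_ℝ : ℝ) : ℂ))) ∧
    ∀ c : Fin N → ℂ,
      (∀ᵐ (n : Metric.sphere (0 : EuclideanSpace ℝ (Fin 3)) 1)
          ∂((volume : Measure (EuclideanSpace ℝ (Fin 3))).toSphere),
        ∑ j : Fin N, c j *
          Complex.exp (-Complex.I * ((a * ⟪(n : EuclideanSpace ℝ (Fin 3)), x j⟫_ℝ : ℝ) : ℂ)) = 0) →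
      c = 0 := by
  refine ⟨?_, fun c hc => ?_⟩
  · rw [Fintype.linearIndependent_iff]
    intro c hc
    refine congrFun (aux_main x hx a ha c fun n => ?_)
    have := congrFun hc n
    simpa only [Finset.sum_apply, Pi.smul_apply, smul_eq_mul, Pi.zero_apply] using this
  · refine aux_main x hx a ha c ?_
    have hcont : Continuous fun n : Metric.sphere (0 : EuclideanSpace ℝ (Fin 3)) 1 =>
        ∑ j : Fin N, c j *
          Complex.exp (-Complex.I *
            ((a * ⟪(n : EuclideanSpace ℝ (Fin 3)), x j⟫_ℝ : ℝ) : ℂ)) := by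
      fun_prop
    exact congrFun (Measure.eq_of_ae_eq hc hcont continuous_const)
end

section
/- Let ζ ∈ ℂ with Im ζ > 0 and Re ζ ≠ 0, and let a, b ∈ ℝ³ with a ≠ b; set r = |a − b|. Then ∫_{ℝ³} (e^{iζ|x−a|}/(4π|x−a|)) · conj(e^{iζ|x−b|}/(4π|x−b|)) dx = Im(e^{iζr}) / (4π·r·Im(ζ²)); equivalently the integral equals e^{−(Im ζ)r}·sin((Re ζ)r) / (8π·r·(Re ζ)·(Im ζ)). -/
open MeasureTheory
open scoped Real

noncomputable section

namespace HGI

def U (p : ℝ × ℝ) : ℝ := √(p.1 ^ 2 + p.2 ^ 2)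
def V (r : ℝ) (p : ℝ × ℝ) : ℝ := √((p.1 - r) ^ 2 + p.2 ^ 2)
def bip (r : ℝ) (p : ℝ × ℝ) : ℝ × ℝ := (U p + V r p, U p - V r p)
def bip' (r : ℝ) (p : ℝ × ℝ) : ℝ × ℝ →L[ℝ] ℝ × ℝ :=
  LinearMap.toContinuousLinearMap
    ((Matrix.toLin (Module.Basis.finTwoProd ℝ) (Module.Basis.finTwoProd ℝ))
      !![p.1 / U p + (p.1 - r) / V r p, p.2 / U p + p.2 / V r p;
         p.1 / U p - (p.1 - r) / V r p, p.2 / U p - p.2 / V r p])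

lemma U_pos (p : ℝ × ℝ) (hp : 0 < p.2) : 0 < U p := Real.sqrt_pos.2 (by positivity)
lemma V_pos (r : ℝ) (p : ℝ × ℝ) (hp : 0 < p.2) : 0 < V r p := Real.sqrt_pos.2 (by positivity)
lemma U_sq (p : ℝ × ℝ) : U p ^ 2 = p.1 ^ 2 + p.2 ^ 2 := Real.sq_sqrt (by positivity)
lemma V_sq (r : ℝ) (p : ℝ × ℝ) : V r p ^ 2 = (p.1 - r) ^ 2 + p.2 ^ 2 :=
  Real.sq_sqrt (by positivity)

lemma hasFDerivAt_bip (r : ℝ) (p : ℝ × ℝ) (hp : 0 < p.2) :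
    HasFDerivAt (bip r) (bip' r p) p := by
  have hu := U_pos p hp
  have hv := V_pos r p hp
  have h1 : HasFDerivAt U ((p.1 / U p) • ContinuousLinearMap.fst ℝ ℝ ℝ
      + (p.2 / U p) • ContinuousLinearMap.snd ℝ ℝ ℝ) p := by
    have := (((hasFDerivAt_fst (𝕜 := ℝ) (p := p)).pow 2).add
      ((hasFDerivAt_snd (𝕜 := ℝ) (p := p)).pow 2)).sqrt (ne_of_gt (by
        simp only [Pi.add_apply, Pi.pow_apply]; positivity))
    refine this.congr_fderiv ?_
    change (1 / (2 * U p)) • _ = _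
    ext <;> simp <;> field_simp
  have h2 : HasFDerivAt (V r) (((p.1 - r) / V r p) • ContinuousLinearMap.fst ℝ ℝ ℝ
      + (p.2 / V r p) • ContinuousLinearMap.snd ℝ ℝ ℝ) p := by
    have := ((((hasFDerivAt_fst (𝕜 := ℝ) (p := p)).sub_const r).pow 2).add
      ((hasFDerivAt_snd (𝕜 := ℝ) (p := p)).pow 2)).sqrt (ne_of_gt (by
        simp only [Pi.add_apply, Pi.pow_apply]; positivity))
    refine this.congr_fderiv ?_
    change (1 / (2 * V r p)) • _ = _
    ext <;> simp <;> field_simp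
  refine ((h1.add h2).prodMk (h1.sub h2)).congr_fderiv ?_
  rw [bip', Matrix.toLin_finTwoProd_toContinuousLinearMap]
  ext <;> simp

lemma det_bip' (r : ℝ) (hr : 0 < r) (p : ℝ × ℝ) (hp : 0 < p.2) :
    |(bip' r p).det| = 2 * r * p.2 / (U p * V r p) := by
  have hu := U_pos p hp
  have hv := V_pos r p hp
  have : (bip' r p).det = -(2 * r * p.2 / (U p * V r p)) := by
    unfold bip'
    simp only [LinearMap.det_toContinuousLinearMap, LinearMap.det_toLin, Matrix.det_fin_two_of]
    field_simp
    ring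
  rw [this, abs_neg, abs_of_pos (by positivity)]

lemma bip_injOn (r : ℝ) (hr : 0 < r) : Set.InjOn (bip r) (Set.univ ×ˢ Set.Ioi 0) := by
  rintro p ⟨-, hp⟩ q ⟨-, hq⟩ h
  simp only [Set.mem_Ioi] at hp hq
  simp only [bip, Prod.mk.injEq] at h
  have hU : U p = U q := by linarith
  have hV : V r p = V r q := by linarith
  have e1 := U_sq p
  have e2 := V_sq r p
  rw [hU, U_sq] at e1
  rw [hV, V_sq] at e2
  have hz : p.1 = q.1 := by
    have : r * p.1 = r * q.1 := by linarith
    exact mul_left_cancel₀ hr.ne' this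
  have hw : p.2 = q.2 := by
    rw [hz] at e1
    have : p.2 ^ 2 = q.2 ^ 2 := by linarith
    exact (pow_left_inj₀ hp.le hq.le two_ne_zero).1 this
  exact Prod.ext hz hw

lemma bip_image (r : ℝ) (hr : 0 < r) :
    bip r '' (Set.univ ×ˢ Set.Ioi 0) = Set.Ioi r ×ˢ Set.Ioo (-r) r := by
  ext q
  constructor
  · rintro ⟨p, ⟨-, hp⟩, rfl⟩
    simp only [Set.mem_Ioi] at hp
    have hu := U_pos p hp
    have hv := V_pos r p hp
    have e1 := U_sq p
    have e2 := V_sq r p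
    have a1 : |p.1| < U p := abs_lt_of_sq_lt_sq (by nlinarith) hu.le
    have a2 : |p.1 - r| < V r p := abs_lt_of_sq_lt_sq (by nlinarith) hv.le
    rw [abs_lt] at a1 a2
    simp only [bip, Set.mem_prod, Set.mem_Ioi, Set.mem_Ioo]
    refine ⟨by linarith, ?_, ?_⟩
    · have : V r p < U p + r := lt_of_pow_lt_pow_left₀ 2 (by positivity) (by nlinarith)
      linarith
    · have : U p < V r p + r := lt_of_pow_lt_pow_left₀ 2 (by positivity) (by nlinarith)
      linarith
  · obtain ⟨s, t⟩ := q
    rintro ⟨hs, ht1, ht2⟩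
    simp only [Set.mem_Ioi] at hs ht1 ht2
    have hpos : 0 < (s ^ 2 - r ^ 2) * (r ^ 2 - t ^ 2) := by
      apply mul_pos <;> nlinarith
    have hsq := Real.sq_sqrt hpos.le
    have hsp := Real.sqrt_pos.2 hpos
    set w := √((s ^ 2 - r ^ 2) * (r ^ 2 - t ^ 2)) with hw
    refine ⟨((s * t + r ^ 2) / (2 * r), w / (2 * r)), ⟨trivial, ?_⟩, ?_⟩
    · simp only [Set.mem_Ioi]; positivity
    · have hU : U ((s * t + r ^ 2) / (2 * r), w / (2 * r)) = (s + t) / 2 := by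
        unfold U
        rw [← Real.sqrt_sq (show 0 ≤ (s + t) / 2 by linarith)]
        congr 1
        simp only [div_pow, hsq]
        field_simp
        ring
      have hV : V r ((s * t + r ^ 2) / (2 * r), w / (2 * r)) = (s - t) / 2 := by
        unfold V
        rw [← Real.sqrt_sq (show 0 ≤ (s - t) / 2 by linarith)]
        congr 1
        simp only [div_pow, hsq]
        field_simp
        ring
      simp only [bip, hU, hV, Prod.mk.injEq]
      constructor <;> ring

def h (α β : ℝ) (q : ℝ × ℝ) : ℂ :=
  Complex.exp ((-β : ℂ) * q.1) * Complex.exp ((Complex.I * α) * q.2)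

lemma h_integrableOn (α β r : ℝ) (hβ : 0 < β) :
    IntegrableOn (h α β) (Set.Ioi r ×ˢ Set.Ioo (-r) r) := by
  have h1 : IntegrableOn (fun x : ℝ => Complex.exp ((-β : ℂ) * x)) (Set.Ioi r) :=
    integrableOn_exp_mul_complex_Ioi (by simpa using hβ) r
  have h2 : IntegrableOn (fun x : ℝ => Complex.exp ((Complex.I * α) * x)) (Set.Ioo (-r) r) :=
    (Continuous.integrableOn_Icc (by fun_prop)).mono_set Set.Ioo_subset_Icc_self
  have := Integrable.mul_prod h1 h2
  rw [Measure.prod_restrict] at this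
  exact this

lemma h_integral (α β r : ℝ) (hβ : 0 < β) (hα : α ≠ 0) (hr : 0 < r) :
    ∫ q in Set.Ioi r ×ˢ Set.Ioo (-r) r, h α β q =
      ((Real.exp (-β * r) / β * (2 * Real.sin (α * r) / α) : ℝ) : ℂ) := by
  have := setIntegral_prod_mul (μ := (volume : Measure ℝ)) (ν := (volume : Measure ℝ))
    (fun x : ℝ => Complex.exp ((-β : ℂ) * x)) (fun x : ℝ => Complex.exp ((Complex.I * α) * x))
    (Set.Ioi r) (Set.Ioo (-r) r)
  refine this.trans ?_
  have hα' : (α : ℂ) ≠ 0 := by exact_mod_cast hα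
  have hβ' : (β : ℂ) ≠ 0 := by exact_mod_cast hβ.ne'
  rw [integral_exp_mul_complex_Ioi (by simpa using hβ), ← integral_Ioc_eq_integral_Ioo,
    ← intervalIntegral.integral_of_le (by linarith), integral_exp_mul_complex (by simp [hα])]
  push_cast
  rw [Complex.sin]
  have e1 : Complex.I * α * r = α * r * Complex.I := by ring
  have e2 : Complex.I * α * -r = -(α * r) * Complex.I := by ring
  rw [e1, e2]
  field_simp
  rw [Complex.I_sq]
  ring

def f (α β r : ℝ) (p : ℝ × ℝ) : ℂ := ((1 / (U p * V r p) : ℝ) : ℂ) * h α β (bip r p)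

lemma smul_eq (α β r : ℝ) (hr : 0 < r) (p : ℝ × ℝ) (hp : p ∈ (Set.univ : Set ℝ) ×ˢ Set.Ioi (0 : ℝ)) :
    |(bip' r p).det| • h α β (bip r p) = (2 * r) • (p.2 • f α β r p) := by
  rw [det_bip' r hr p hp.2, f]
  simp only [Complex.real_smul]
  push_cast
  ring

lemma meas_set : MeasurableSet ((Set.univ : Set ℝ) ×ˢ Set.Ioi (0 : ℝ)) :=
  MeasurableSet.univ.prod measurableSet_Ioi

lemma half_integrable (α β r : ℝ) (hβ : 0 < β) (hr : 0 < r) :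
    IntegrableOn (fun p : ℝ × ℝ => p.2 • f α β r p) (Set.univ ×ˢ Set.Ioi 0) := by
  have := (integrableOn_image_iff_integrableOn_abs_det_fderiv_smul volume meas_set
    (fun p hp => (hasFDerivAt_bip r p hp.2).hasFDerivWithinAt) (bip_injOn r hr) (h α β)).1
    (by rw [bip_image r hr]; exact h_integrableOn α β r hβ)
  rw [integrableOn_congr_fun (smul_eq α β r hr) meas_set] at this
  have h2 := this.smul (2 * r)⁻¹
  refine h2.congr (Filter.Eventually.of_forall fun p => ?_)
  simp only [Pi.smul_apply]
  rw [smul_smul, inv_mul_cancel₀ (by positivity), one_smul]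

lemma half_integral (α β r : ℝ) (hβ : 0 < β) (hα : α ≠ 0) (hr : 0 < r) :
    ∫ z : ℝ, ∫ ρ in Set.Ioi (0 : ℝ), ρ • f α β r (z, ρ) =
      ((Real.exp (-β * r) * Real.sin (α * r) / (r * α * β) : ℝ) : ℂ) := by
  have key := integral_image_eq_integral_abs_det_fderiv_smul volume meas_set
    (fun p hp => (hasFDerivAt_bip r p hp.2).hasFDerivWithinAt) (bip_injOn r hr) (h α β)
  rw [bip_image r hr, h_integral α β r hβ hα hr,
    setIntegral_congr_fun meas_set (smul_eq α β r hr), integral_smul] at key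
  have h3 := setIntegral_prod (μ := (volume : Measure ℝ)) (ν := (volume : Measure ℝ)) _
    (half_integrable α β r hβ hr)
  rw [setIntegral_univ] at h3
  rw [← h3]
  change _ = (2 * r) • (∫ p in (Set.univ : Set ℝ) ×ˢ Set.Ioi (0 : ℝ), p.2 • f α β r p
    ∂(volume.prod volume)) at key
  rw [← smul_right_inj (show (2 * r : ℝ) ≠ 0 by positivity), ← key]
  rw [Complex.real_smul]
  norm_cast
  field_simp

abbrev E3 := EuclideanSpace ℝ (Fin 3)
abbrev E2 := EuclideanSpace ℝ (Fin 2)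

def c0 (r : ℝ) : E3 := EuclideanSpace.single 0 r

def g (α β : ℝ) (r : ℝ) (x : E3) : ℂ :=
  ((1 / (‖x‖ * ‖x - c0 r‖) : ℝ) : ℂ) * h α β (‖x‖ + ‖x - c0 r‖, ‖x‖ - ‖x - c0 r‖)

lemma g_eq (α β r : ℝ) (x : E3) : g α β r x = f α β r (x 0, √(x 1 ^ 2 + x 2 ^ 2)) := by
  have h1 : ‖x‖ = U (x 0, √(x 1 ^ 2 + x 2 ^ 2)) := by
    rw [EuclideanSpace.norm_eq, U, Real.sq_sqrt (by positivity)]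
    simp [Fin.sum_univ_three, add_assoc]
  have h2 : ‖x - c0 r‖ = V r (x 0, √(x 1 ^ 2 + x 2 ^ 2)) := by
    rw [EuclideanSpace.norm_eq, V, Real.sq_sqrt (by positivity)]
    simp [Fin.sum_univ_three, c0, add_assoc]
  rw [g, f, bip, h1, h2]

lemma exp_integrable (β : ℝ) (hβ : 0 < β) :
    Integrable (fun x : E3 => Real.exp (-β * ‖x‖) / ‖x‖ ^ 2) := by
  have := integrable_fun_norm_addHaar (E := E3) volume (f := fun y : ℝ => Real.exp (-β * y) / y ^ 2)
  refine this.2 ?_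
  have h1 : IntegrableOn (fun x : ℝ => Real.exp (-β * x)) (Set.Ioi 0) :=
    integrableOn_exp_mul_Ioi (by linarith) 0
  refine h1.congr_fun (fun y hy => ?_) measurableSet_Ioi
  have hy : y ≠ 0 := ne_of_gt hy
  simp
  field_simp

lemma g_integrable (α β r : ℝ) (hβ : 0 < β) : Integrable (g α β r) := by
  have h1 := exp_integrable β hβ
  have h2 := h1.comp_sub_right (c0 r)
  refine (h1.add h2).mono' ?_ (Filter.Eventually.of_forall fun x => ?_)
  · apply Measurable.aestronglyMeasurable
    unfold g h
    fun_prop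
  · have hu := norm_nonneg x
    have hv := norm_nonneg (x - c0 r)
    simp only [g, h, norm_mul, Complex.norm_exp, Pi.add_apply, Complex.norm_real]
    set u := ‖x‖
    set v := ‖x - c0 r‖
    have e1 : ((-β : ℂ) * ((u + v : ℝ) : ℂ)).re = -β * u + -β * v := by
      simp; ring
    have e2 : (Complex.I * α * ((u - v : ℝ) : ℂ)).re = 0 := by simp
    simp only [e1, e2, Real.exp_zero, mul_one, Real.exp_add]
    rw [Real.norm_of_nonneg (by positivity)]
    have p1 : Real.exp (-β * u) ≤ 1 := Real.exp_le_one_iff.2 (by nlinarith)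
    have p2 : Real.exp (-β * v) ≤ 1 := Real.exp_le_one_iff.2 (by nlinarith)
    have p3 := Real.exp_pos (-β * u)
    have p4 := Real.exp_pos (-β * v)
    set A := Real.exp (-β * u)
    set B := Real.exp (-β * v)
    have q1 : 1 / (u * v) = u⁻¹ * v⁻¹ := by rw [one_div, mul_inv]
    rw [q1, div_eq_mul_inv, div_eq_mul_inv, ← inv_pow, ← inv_pow]
    have hi : 0 ≤ u⁻¹ := by positivity
    have hj : 0 ≤ v⁻¹ := by positivity
    set i := u⁻¹
    set j := v⁻¹
    have k1 : i * j ≤ (i ^ 2 + j ^ 2) := by nlinarith [sq_nonneg (i - j)]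
    calc i * j * (A * B) ≤ (i ^ 2 + j ^ 2) * (A * B) := by gcongr
      _ = A * i ^ 2 * B + B * j ^ 2 * A := by ring
      _ ≤ A * i ^ 2 * 1 + B * j ^ 2 * 1 := by gcongr
      _ = _ := by ring

lemma radial (F : ℝ → ℂ) : ∫ y : Fin 2 → ℝ, F (√(y 0 ^ 2 + y 1 ^ 2)) =
    (2 * π) • ∫ ρ in Set.Ioi (0 : ℝ), ρ • F ρ := by
  have h1 := (PiLp.volume_preserving_ofLp (Fin 2)).integral_comp
    (MeasurableEquiv.toLp 2 (Fin 2 → ℝ)).symm.measurableEmbedding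
    (fun y : Fin 2 → ℝ => F (√(y 0 ^ 2 + y 1 ^ 2)))
  rw [← h1]
  have h2 := integral_fun_norm_addHaar (E := E2) volume F
  have h3 : ∀ x : E2, F (√(x.ofLp 0 ^ 2 + x.ofLp 1 ^ 2)) = F ‖x‖ := by
    intro x
    rw [EuclideanSpace.norm_eq]
    simp
  simp only [h3]
  rw [h2, measureReal_def, EuclideanSpace.volume_ball_fin_two]
  simp [Real.pi_pos.le]
  ring

lemma g_integral (α β r : ℝ) (hβ : 0 < β) (hα : α ≠ 0) (hr : 0 < r) :
    ∫ x, g α β r x =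
      ((2 * π * (Real.exp (-β * r) * Real.sin (α * r) / (r * α * β)) : ℝ) : ℂ) := by
  have m1 := PiLp.volume_preserving_toLp (Fin 3)
  have e1 := (MeasurableEquiv.toLp 2 (Fin 3 → ℝ)).measurableEmbedding
  have m2 := (volume_preserving_piFinSuccAbove (fun _ : Fin 3 => ℝ) 0).symm
  have e2 := (MeasurableEquiv.piFinSuccAbove (fun _ : Fin 3 => ℝ) 0).symm.measurableEmbedding
  have i1 := (m1.integrable_comp_emb e1).2 (g_integrable α β r hβ)
  have i2 := (m2.integrable_comp_emb e2).2 i1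
  rw [← m1.integral_comp e1, ← m2.integral_comp e2]
  refine (integral_prod _ i2).trans ?_
  have : ∀ (z : ℝ) (y : Fin 2 → ℝ), g α β r (WithLp.toLp 2
      ((MeasurableEquiv.piFinSuccAbove (fun _ : Fin 3 => ℝ) 0).symm (z, y))) =
      f α β r (z, √(y 0 ^ 2 + y 1 ^ 2)) := by
    intro z y
    rw [g_eq]
    rfl
  have h2 : ∀ z : ℝ, ∫ y : Fin 2 → ℝ, f α β r (z, √(y 0 ^ 2 + y 1 ^ 2)) =
    (2 * π) • ∫ ρ in Set.Ioi (0 : ℝ), ρ • f α β r (z, ρ) := fun z =>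
    radial (fun ρ => f α β r (z, ρ))
  refine (integral_congr_ae (Filter.Eventually.of_forall fun z =>
    (integral_congr_ae (Filter.Eventually.of_forall (this z))).trans (h2 z))).trans ?_
  rw [integral_smul, half_integral α β r hβ hα hr, Complex.real_smul]
  norm_cast

lemma reduce (G : ℝ → ℝ → ℂ) (a b : E3) :
    ∫ x : E3, G ‖x - a‖ ‖x - b‖ = ∫ x : E3, G ‖x‖ ‖x - c0 ‖a - b‖‖ := by
  rw [← integral_add_right_eq_self _ a]
  have hn : ‖b - a‖ = ‖c0 ‖a - b‖‖ := by simp [c0, norm_sub_rev]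
  have hR := Submodule.reflection_sub hn
  set R := (Submodule.span ℝ {(b - a) - c0 ‖a - b‖})ᗮ.reflection with hRdef
  rw [← R.measurePreserving.integral_comp R.toHomeomorph.measurableEmbedding
    (fun x : E3 => G ‖x‖ ‖x - c0 ‖a - b‖‖)]
  congr 1
  ext x
  have e1 : ‖R x‖ = ‖x‖ := R.norm_map x
  have e2 : ‖R x - c0 ‖a - b‖‖ = ‖x + a - b‖ := by
    rw [← hR, ← map_sub, R.norm_map]
    congr 1
    abel
  rw [e1, e2, add_sub_cancel_right]

lemma integrand_eq (ζ : ℂ) (u v : ℝ) :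
    (Complex.exp (Complex.I * ζ * (u : ℂ)) / ((4 * π * u : ℝ) : ℂ)) *
          (starRingEnd ℂ)
            (Complex.exp (Complex.I * ζ * (v : ℂ)) / ((4 * π * v : ℝ) : ℂ)) =
    ((1 / (16 * π ^ 2) : ℝ) : ℂ) *
      (((1 / (u * v) : ℝ) : ℂ) * h ζ.re ζ.im (u + v, u - v)) := by
  have e : Complex.exp (Complex.I * ζ * u) * Complex.exp (-Complex.I * (starRingEnd ℂ) ζ * v)
      = h ζ.re ζ.im (u + v, u - v) := by
    rw [h, ← Complex.exp_add, ← Complex.exp_add]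
    congr 1
    apply Complex.ext <;> simp <;> ring
  rw [← e, map_div₀, ← Complex.exp_conj]
  simp only [map_mul, Complex.conj_I, Complex.conj_ofReal]
  push_cast
  ring

end HGI

end

/-- Inner product of two shifted Helmholtz Green's functions: for `Im ζ > 0`,
`Re ζ ≠ 0` and distinct `a, b ∈ ℝ³` with `r = |a - b|`,
`∫ g_{ζ,a}·conj(g_{ζ,b}) = Im(e^{iζr})/(4π·r·Im(ζ²))
  = e^{-(Im ζ)r}·sin((Re ζ)r)/(8π·r·(Re ζ)·(Im ζ))`. -/
theorem helmholtz_green_inner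
    (ζ : ℂ) (hζim : 0 < ζ.im) (hζre : ζ.re ≠ 0)
    (a b : EuclideanSpace ℝ (Fin 3)) (hab : a ≠ b)
    (r : ℝ) (hr : r = ‖a - b‖) :
    (∫ x : EuclideanSpace ℝ (Fin 3),
        (Complex.exp (Complex.I * ζ * (‖x - a‖ : ℂ)) / ((4 * π * ‖x - a‖ : ℝ) : ℂ)) *
          (starRingEnd ℂ)
            (Complex.exp (Complex.I * ζ * (‖x - b‖ : ℂ)) / ((4 * π * ‖x - b‖ : ℝ) : ℂ)))
      = (((Complex.exp (Complex.I * ζ * (r : ℂ))).im / (4 * π * r * (ζ ^ 2).im) : ℝ) : ℂ) ∧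
    (((Complex.exp (Complex.I * ζ * (r : ℂ))).im / (4 * π * r * (ζ ^ 2).im) : ℝ)
      = Real.exp (-(ζ.im) * r) * Real.sin (ζ.re * r) / (8 * π * r * ζ.re * ζ.im)) := by
  have hr0 : 0 < r := by rw [hr]; exact norm_pos_iff.2 (sub_ne_zero.2 hab)
  have h2 : (((Complex.exp (Complex.I * ζ * (r : ℂ))).im / (4 * π * r * (ζ ^ 2).im) : ℝ)
      = Real.exp (-(ζ.im) * r) * Real.sin (ζ.re * r) / (8 * π * r * ζ.re * ζ.im)) := by
    have e1 : (ζ ^ 2).im = 2 * ζ.re * ζ.im := by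
      rw [sq, Complex.mul_im]; ring
    rw [Complex.exp_im, e1]
    have e2 : (Complex.I * ζ * (r : ℂ)).re = -ζ.im * r := by simp
    have e3 : (Complex.I * ζ * (r : ℂ)).im = ζ.re * r := by simp
    rw [e2, e3]
    congr 1
    ring
  refine ⟨?_, h2⟩
  rw [h2]
  simp only [HGI.integrand_eq]
  rw [integral_const_mul]
  have h3 := HGI.reduce (fun u v => ((1 / (u * v) : ℝ) : ℂ) * HGI.h ζ.re ζ.im (u + v, u - v)) a b
  have h4 := HGI.g_integral ζ.re ζ.im r hζim hζre hr0
  rw [← hr] at h3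
  have h5 := h3.trans h4
  rw [h5]
  norm_cast
  have := Real.pi_pos
  field_simp
  ring
end

section
/- Let (x_n)_{n∈ℤ} be an injective family of points in ℝ³ with x₀ ≠ 0. Define δ₀ = |x₀| and, for n ≥ 1, δ_n = min{ |x_j − x_k| : −n ≤ j, k ≤ n, j ≠ k } (a positive real number). Let ζ ∈ ℂ with Im ζ ≥ 0, and let b : ℤ × ℤ → ℂ be Hermitian (b_{mn} = conj(b_{nm})) and satisfy Σ_{n∈ℤ} (Σ_{m∈ℤ} |b_{nm}|)² < ∞ and Σ_{n∈ℤ} (Σ_{m∈ℤ} |b_{nm}|/δ_{|m|})² < ∞. Then: (i) for all m, n ∈ ℤ the double series u_{mn} = Σ_{n'≠m'} b_{n n'} · (e^{iζ|x_{n'}−x_{m'}|}/(4π|x_{n'}−x_{m'}|)) · b_{m' m} converges absolutely; and (ii) Σ_{m,n∈ℤ} |u_{mn}|² < ∞. -/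
open scoped Real

/-- Hilbert–Schmidt estimate for the off-diagonal part
`u_{mn} = ∑_{n'≠m'} b_{nn'}·(e^{iζ|x_{n'}-x_{m'}|}/(4π|x_{n'}-x_{m'}|))·b_{m'm}`
of `|L|^{-1/2}Q(z)|L|^{-1/2}` in the proof of Theorem 2.2: under the
summability conditions on the Hermitian matrix `b` weighted by the separation
numbers `δ`, each double series converges absolutely and `∑_{m,n}|u_{mn}|² < ∞`. -/
theorem offdiagonal_hilbert_schmidt
    (x : ℤ → EuclideanSpace ℝ (Fin 3)) (hx : Function.Injective x)
    (hx0 : x 0 ≠ 0)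
    (δ : ℕ → ℝ) (hδ0 : δ 0 = ‖x 0‖)
    (hδ : ∀ n : ℕ, 1 ≤ n →
      IsLeast {d : ℝ | ∃ j k : ℤ, j ≠ k ∧ |j| ≤ (n : ℤ) ∧ |k| ≤ (n : ℤ) ∧
        d = ‖x j - x k‖} (δ n))
    (ζ : ℂ) (hζ : 0 ≤ ζ.im)
    (b : ℤ → ℤ → ℂ) (hbherm : ∀ m n : ℤ, b m n = (starRingEnd ℂ) (b n m))
    (hb1 : ∀ n : ℤ, Summable fun m : ℤ => ‖b n m‖)
    (hb2 : Summable fun n : ℤ => (∑' m : ℤ, ‖b n m‖) ^ 2)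
    (hb3 : ∀ n : ℤ, Summable fun m : ℤ => ‖b n m‖ / δ m.natAbs)
    (hb4 : Summable fun n : ℤ => (∑' m : ℤ, ‖b n m‖ / δ m.natAbs) ^ 2) :
    (∀ m n : ℤ, Summable fun p : ℤ × ℤ =>
      ‖if p.1 = p.2 then (0 : ℂ) else
        b n p.1 * (Complex.exp (Complex.I * ζ * (‖x p.1 - x p.2‖ : ℂ)) /
          ((4 * π * ‖x p.1 - x p.2‖ : ℝ) : ℂ)) * b p.2 m‖) ∧
    Summable fun mn : ℤ × ℤ =>
      ‖∑' p : ℤ × ℤ, if p.1 = p.2 then (0 : ℂ) else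
        b mn.2 p.1 * (Complex.exp (Complex.I * ζ * (‖x p.1 - x p.2‖ : ℂ)) /
          ((4 * π * ‖x p.1 - x p.2‖ : ℝ) : ℂ)) * b p.2 mn.1‖ ^ 2 := by
  have hpos : ∀ n : ℕ, 0 < δ n := by
    intro n
    rcases Nat.eq_zero_or_pos n with h | h
    · subst h
      rw [hδ0]
      exact norm_pos_iff.mpr hx0
    · obtain ⟨j, k, hjk, -, -, hd⟩ := (hδ n h).1
      rw [hd]
      exact norm_pos_iff.mpr (sub_ne_zero.mpr (fun h => hjk (hx h)))
  have hsep : ∀ j k : ℤ, j ≠ k →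
      1 / ‖x j - x k‖ ≤ 1 / δ j.natAbs + 1 / δ k.natAbs := by
    intro j k hjk
    have h1 : 0 < 1 / δ j.natAbs := one_div_pos.mpr (hpos _)
    have h2 : 0 < 1 / δ k.natAbs := one_div_pos.mpr (hpos _)
    rcases le_total j.natAbs k.natAbs with h | h
    · have hle : δ k.natAbs ≤ ‖x j - x k‖ :=
        (hδ k.natAbs (by omega)).2 ⟨j, k, hjk, by simp only [Int.abs_eq_natAbs]; lia, by simp only [Int.abs_eq_natAbs]; lia, rfl⟩
      have := one_div_le_one_div_of_le (hpos _) hle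
      linarith
    · have hle : δ j.natAbs ≤ ‖x j - x k‖ :=
        (hδ j.natAbs (by omega)).2 ⟨j, k, hjk, by simp only [Int.abs_eq_natAbs]; lia, by simp only [Int.abs_eq_natAbs]; lia, rfl⟩
      have := one_div_le_one_div_of_le (hpos _) hle
      linarith
  have hker : ∀ r : ℝ, 0 < r →
      ‖Complex.exp (Complex.I * ζ * (r : ℂ)) / ((4 * π * r : ℝ) : ℂ)‖ ≤ 1 / r := by
    intro r hr
    rw [norm_div, Complex.norm_exp, Complex.norm_real, Real.norm_of_nonneg (by positivity)]
    have hre : (Complex.I * ζ * (r : ℂ)).re = -(ζ.im * r) := by simp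
    rw [hre]
    have he : Real.exp (-(ζ.im * r)) ≤ 1 :=
      Real.exp_le_one_iff.mpr (by have := mul_nonneg hζ hr.le; linarith)
    have hp : r ≤ 4 * π * r := by nlinarith [Real.pi_gt_three]
    exact div_le_div₀ zero_le_one he hr hp
  have hsym : ∀ m n : ℤ, ‖b m n‖ = ‖b n m‖ := by
    intro m n
    rw [hbherm m n, RCLike.norm_conj]
  have hterm : ∀ (m n : ℤ) (p : ℤ × ℤ),
      ‖if p.1 = p.2 then (0 : ℂ) else
        b n p.1 * (Complex.exp (Complex.I * ζ * (‖x p.1 - x p.2‖ : ℂ)) /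
          ((4 * π * ‖x p.1 - x p.2‖ : ℝ) : ℂ)) * b p.2 m‖ ≤
      (‖b n p.1‖ / δ p.1.natAbs) * ‖b m p.2‖ + ‖b n p.1‖ * (‖b m p.2‖ / δ p.2.natAbs) := by
    intro m n p
    have h1 := hpos p.1.natAbs
    have h2 := hpos p.2.natAbs
    split_ifs with h
    · rw [norm_zero]
      positivity
    · have hr : 0 < ‖x p.1 - x p.2‖ :=
        norm_pos_iff.mpr (sub_ne_zero.mpr (fun h' => h (hx h')))
      rw [norm_mul, norm_mul, hsym p.2 m]
      have hk := (hker _ hr).trans (hsep _ _ h)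
      calc _ ≤ ‖b n p.1‖ * (1 / δ p.1.natAbs + 1 / δ p.2.natAbs) * ‖b m p.2‖ := by gcongr
        _ = _ := by ring
  have hD0 : ∀ n m : ℤ, 0 ≤ ‖b n m‖ / δ m.natAbs := fun n m =>
    div_nonneg (norm_nonneg _) (hpos _).le
  have hs1 : ∀ m n : ℤ, Summable fun p : ℤ × ℤ => (‖b n p.1‖ / δ p.1.natAbs) * ‖b m p.2‖ :=
    fun m n => (hb3 n).mul_of_nonneg (hb1 m) (hD0 n) (fun _ => norm_nonneg _)
  have hs2 : ∀ m n : ℤ, Summable fun p : ℤ × ℤ => ‖b n p.1‖ * (‖b m p.2‖ / δ p.2.natAbs) :=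
    fun m n => (hb1 n).mul_of_nonneg (hb3 m) (fun _ => norm_nonneg _) (hD0 m)
  have hmain : ∀ m n : ℤ, Summable fun p : ℤ × ℤ =>
      ‖if p.1 = p.2 then (0 : ℂ) else
        b n p.1 * (Complex.exp (Complex.I * ζ * (‖x p.1 - x p.2‖ : ℂ)) /
          ((4 * π * ‖x p.1 - x p.2‖ : ℝ) : ℂ)) * b p.2 m‖ := fun m n =>
    Summable.of_nonneg_of_le (fun _ => norm_nonneg _) (hterm m n) ((hs1 m n).add (hs2 m n))
  refine ⟨hmain, ?_⟩
  have hS := hb2.mul_of_nonneg hb4 (fun _ => sq_nonneg _) (fun _ => sq_nonneg _)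
  have hT := hb4.mul_of_nonneg hb2 (fun _ => sq_nonneg _) (fun _ => sq_nonneg _)
  refine Summable.of_nonneg_of_le (fun _ => sq_nonneg _) ?_ ((hS.add hT).mul_left 2)
  rintro ⟨m, n⟩
  have hle := (norm_tsum_le_tsum_norm (hmain m n)).trans
    ((hmain m n).tsum_le_tsum (hterm m n) ((hs1 m n).add (hs2 m n)))
  rw [(hs1 m n).tsum_add (hs2 m n), ← (hb3 n).tsum_mul_tsum (hb1 m) (hs1 m n),
    ← (hb1 n).tsum_mul_tsum (hb3 m) (hs2 m n)] at hle
  refine (pow_le_pow_left₀ (norm_nonneg _) hle 2).trans ?_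
  dsimp only
  generalize (∑' k : ℤ, ‖b n k‖ / δ k.natAbs) = A
  generalize (∑' k : ℤ, ‖b m k‖ / δ k.natAbs) = B
  generalize (∑' k : ℤ, ‖b n k‖) = C
  generalize (∑' k : ℤ, ‖b m k‖) = D
  nlinarith [sq_nonneg (A * D - C * B)]
end

section
/- Let (x_n)_{n∈ℤ} be an injective family of points in ℝ³ and c : ℤ → ℂ satisfy Σ_{n∈ℤ} |c_n| < ∞ and Σ_{m≠n} |c_m|·|c_n|/|x_m − x_n| < ∞. Let z ∈ ℂ with Im z ≠ 0 and let ζ be the unique square root of z with Im ζ > 0. Define F = Σ_{m,n∈ℤ} conj(c_m)·c_n·q_{mn}, where q_{mn} = e^{iζ|x_m−x_n|}/(4π|x_m−x_n|) for m ≠ n and q_{mm} = iζ/(4π). Then Im(F)/Im(z) = (2π)^{−3} ∫_{ℝ³} |Σ_{n∈ℤ} c_n·e^{−i⟨k, x_n⟩}|² / ((|k|² − Re z)² + (Im z)²) dk; in particular Im(F)/Im(z) ≥ 0. -/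
open MeasureTheory
open scoped InnerProductSpace Real

lemma den_pos {a b : ℝ} (hb : b ≠ 0) (t : ℝ) : 0 < (t - a) ^ 2 + b ^ 2 := by positivity

lemma den_bound {a b : ℝ} (hb : b ≠ 0) (t : ℝ) :
    (1 + t) ^ 2 ≤ (2 + 2 * (1 + a) ^ 2 / b ^ 2) * ((t - a) ^ 2 + b ^ 2) := by
  have h : (2 + 2 * (1 + a) ^ 2 / b ^ 2) * ((t - a) ^ 2 + b ^ 2)
      = 2 * (t - a) ^ 2 + 2 * (1 + a) ^ 2 + 2 * b ^ 2 + 2 * (1 + a) ^ 2 / b ^ 2 * (t - a) ^ 2 := by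
    field_simp; ring
  rw [h]
  have h2 : 0 ≤ 2 * (1 + a) ^ 2 / b ^ 2 * (t - a) ^ 2 := by positivity
  nlinarith [sq_nonneg (t - a - (1 + a)), sq_nonneg b]

lemma den_inv_bound {a b : ℝ} (hb : b ≠ 0) (t : ℝ) (ht : 0 ≤ t) :
    1 / ((t - a) ^ 2 + b ^ 2) ≤ (2 + 2 * (1 + a) ^ 2 / b ^ 2) * (1 + t) ^ (-(4 : ℝ) / 2) := by
  have e : (-(4 : ℝ) / 2) = -((2 : ℕ) : ℝ) := by norm_num
  rw [e, Real.rpow_neg (by positivity), Real.rpow_natCast, ← div_eq_mul_inv,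
    div_le_div_iff₀ (den_pos hb t) (by positivity), one_mul]
  exact den_bound hb t

lemma int3 {a b : ℝ} (hb : b ≠ 0) :
    Integrable fun k : EuclideanSpace ℝ (Fin 3) => 1 / ((‖k‖ ^ 2 - a) ^ 2 + b ^ 2) := by
  have h := (integrable_rpow_neg_one_add_norm_sq (E := EuclideanSpace ℝ (Fin 3)) (r := 4)
    (μ := volume) (by simp; norm_num)).const_mul (2 + 2 * (1 + a) ^ 2 / b ^ 2)
  refine h.mono' ?_ (Filter.Eventually.of_forall fun k => ?_)
  · refine Continuous.aestronglyMeasurable ?_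
    exact continuous_const.div (by fun_prop) fun k => (den_pos hb _).ne'
  · rw [Real.norm_of_nonneg (by have := den_pos (a := a) hb (‖k‖^2); positivity)]
    exact den_inv_bound hb _ (by positivity)

lemma int1 {a b : ℝ} (hb : b ≠ 0) :
    Integrable fun s : ℝ => s / ((s ^ 2 - a) ^ 2 + b ^ 2) := by
  have h := integrable_inv_one_add_sq.const_mul (2 + 2 * (1 + a) ^ 2 / b ^ 2)
  refine h.mono' ?_ (Filter.Eventually.of_forall fun s => ?_)
  · refine Continuous.aestronglyMeasurable ?_
    exact continuous_id.div (by fun_prop) fun k => (den_pos hb _).ne'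
  · rw [norm_div, Real.norm_of_nonneg (den_pos hb _).le, ← div_eq_mul_inv,
      div_le_div_iff₀ (den_pos hb _) (by positivity)]
    have h1 := den_bound (a := a) hb (s ^ 2)
    have h2 : ‖s‖ ≤ 1 + s ^ 2 := by
      rw [Real.norm_eq_abs]; nlinarith [sq_abs s, sq_nonneg (|s| - 1)]
    nlinarith [sq_nonneg s]

lemma intExp {η : ℝ} (hη : 0 < η) : Integrable fun r : ℝ => Real.exp (-η * |r|) := by
  have h1 : IntegrableOn (fun r : ℝ => Real.exp (-η * |r|)) (Set.Ioi 0) := by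
    refine (exp_neg_integrableOn_Ioi 0 hη).congr_fun (fun r hr => ?_) measurableSet_Ioi
    simp only; rw [abs_of_pos hr]
  rw [← integrableOn_univ, ← Set.Iic_union_Ioi (a := (0 : ℝ))]
  refine IntegrableOn.union ?_ h1
  have := (integrableOn_Iic_iff_integrableOn_Iio (f := fun r : ℝ => Real.exp (-η * |r|)) (μ := volume) (b := 0))
  rw [this]
  have h2 := h1.comp_neg
  simpa using h2

noncomputable def GG (ζ : ℂ) (r : ℝ) : ℂ :=
  ((Real.exp (-ζ.im * |r|) * Real.sin (ζ.re * r) : ℝ) : ℂ)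

lemma GG_neg (ζ : ℂ) (r : ℝ) : GG ζ (-r) = - GG ζ r := by
  simp [GG]

lemma GG_pos (ζ : ℂ) {r : ℝ} (hr : 0 ≤ r) :
    GG ζ r = (Complex.exp (Complex.I * ζ * r) -
      Complex.exp (-Complex.I * (starRingEnd ℂ) ζ * r)) / (2 * Complex.I) := by
  have h1 : Complex.I * ζ * r = ((-ζ.im * r : ℝ) : ℂ) + ((ζ.re * r : ℝ) : ℂ) * Complex.I := by
    apply Complex.ext <;> simp
  have h2 : -Complex.I * (starRingEnd ℂ) ζ * r =
      ((-ζ.im * r : ℝ) : ℂ) + ((-(ζ.re * r) : ℝ) : ℂ) * Complex.I := by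
    apply Complex.ext <;> simp
  rw [h1, h2, Complex.exp_add, Complex.exp_add, GG, abs_of_nonneg hr]
  simp only [Complex.ofReal_mul, Complex.ofReal_exp, Complex.ofReal_sin]
  rw [Complex.sin]
  have := Complex.I_ne_zero
  field_simp
  push_cast
  rw [Complex.I_sq]
  ring_nf

lemma GG_int {ζ : ℂ} (hζ : 0 < ζ.im) : Integrable (GG ζ) := by
  refine (intExp hζ).mono' ?_ (Filter.Eventually.of_forall fun r => ?_)
  · apply Continuous.aestronglyMeasurable; unfold GG; fun_prop
  · rw [GG, Complex.norm_real, norm_mul, Real.norm_of_nonneg (Real.exp_pos _).le]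
    exact mul_le_of_le_one_right (Real.exp_pos _).le (Real.abs_sin_le_one _)

lemma GG_transform {ζ : ℂ} (hζ : 0 < ζ.im) (s : ℝ) :
    ∫ r : ℝ, Complex.exp (-(Complex.I * s * r)) * GG ζ r =
      -2 * Complex.I * (ζ ^ 2).im *
        ((s / ((s ^ 2 - (ζ ^ 2).re) ^ 2 + (ζ ^ 2).im ^ 2) : ℝ) : ℂ) := by
  set f : ℝ → ℂ := fun r => Complex.exp (-(Complex.I * s * r)) * GG ζ r with hf
  have hint : Integrable f := by
    refine (GG_int hζ).norm.mono' ?_ (Filter.Eventually.of_forall fun r => ?_)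
    · apply Continuous.aestronglyMeasurable; unfold f GG; fun_prop
    · simp [hf, Complex.norm_exp]
  rw [← intervalIntegral.integral_Iic_add_Ioi (b := (0:ℝ)) hint.integrableOn hint.integrableOn]
  have h0 : ∫ r in Set.Iic (0:ℝ), f r = ∫ r in Set.Ioi (0:ℝ), f (-r) := by
    rw [integral_comp_neg_Ioi]; simp
  rw [h0, ← integral_add hint.comp_neg.integrableOn hint.integrableOn]
  have key : ∀ r ∈ Set.Ioi (0:ℝ), f (-r) + f r =
      (1 / (2 * Complex.I)) * (
       Complex.exp ((Complex.I * (ζ - s)) * r) - Complex.exp ((Complex.I * (ζ + s)) * r)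
       - Complex.exp ((-Complex.I * ((starRingEnd ℂ) ζ + s)) * r)
       + Complex.exp ((-Complex.I * ((starRingEnd ℂ) ζ - s)) * r)) := by
    intro r hr
    simp only [hf]
    rw [GG_neg, GG_pos ζ (le_of_lt hr)]
    have e1 : (Complex.I * (ζ - s)) * r = -(Complex.I * s * r) + Complex.I * ζ * r := by ring
    have e2 : (Complex.I * (ζ + s)) * r = Complex.I * s * r + Complex.I * ζ * r := by ring
    have e3 : (-Complex.I * ((starRingEnd ℂ) ζ + s)) * r = -(Complex.I * s * r) + -Complex.I * (starRingEnd ℂ) ζ * r := by ring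
    have e4 : (-Complex.I * ((starRingEnd ℂ) ζ - s)) * r = (Complex.I * s * r) + -Complex.I * (starRingEnd ℂ) ζ * r := by ring
    rw [e1, e2, e3, e4, Complex.exp_add, Complex.exp_add, Complex.exp_add, Complex.exp_add]
    push_cast
    rw [show -(Complex.I * s * -(r:ℂ)) = Complex.I * s * r by ring]
    ring
  rw [setIntegral_congr_fun measurableSet_Ioi key]
  have r1 : (Complex.I * (ζ - s)).re < 0 := by simpa using hζ
  have r2 : (Complex.I * (ζ + s)).re < 0 := by simpa using hζ
  have r3 : (-Complex.I * ((starRingEnd ℂ) ζ + s)).re < 0 := by simpa using hζ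
  have r4 : (-Complex.I * ((starRingEnd ℂ) ζ - s)).re < 0 := by simpa using hζ
  have i1 := integrableOn_exp_mul_complex_Ioi r1 0
  have i2 := integrableOn_exp_mul_complex_Ioi r2 0
  have i3 := integrableOn_exp_mul_complex_Ioi r3 0
  have i4 := integrableOn_exp_mul_complex_Ioi r4 0
  have j12 : IntegrableOn (fun x : ℝ => Complex.exp ((Complex.I * (ζ - s)) * x) -
      Complex.exp ((Complex.I * (ζ + s)) * x)) (Set.Ioi 0) := i1.sub i2
  have j123 : IntegrableOn (fun x : ℝ => Complex.exp ((Complex.I * (ζ - s)) * x) -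
      Complex.exp ((Complex.I * (ζ + s)) * x) -
      Complex.exp ((-Complex.I * ((starRingEnd ℂ) ζ + s)) * x)) (Set.Ioi 0) := j12.sub i3
  rw [integral_const_mul, integral_add j123 i4, integral_sub j12 i3,
    integral_sub i1 i2, integral_exp_mul_complex_Ioi r1, integral_exp_mul_complex_Ioi r2,
    integral_exp_mul_complex_Ioi r3, integral_exp_mul_complex_Ioi r4]
  have n1 : ζ - s ≠ 0 := fun h => by simp [h] at r1
  have n2 : ζ + s ≠ 0 := fun h => by simp [h] at r2
  have n3 : (starRingEnd ℂ) ζ + s ≠ 0 := fun h => by simp [h] at r3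
  have n4 : (starRingEnd ℂ) ζ - s ≠ 0 := fun h => by simp [h] at r4
  have hD : (((s ^ 2 - (ζ ^ 2).re) ^ 2 + (ζ ^ 2).im ^ 2 : ℝ) : ℂ) =
      (ζ - s) * (ζ + s) * (((starRingEnd ℂ) ζ + s) * ((starRingEnd ℂ) ζ - s)) := by
    apply Complex.ext <;> simp [pow_two] <;> ring
  have hI : ((ζ ^ 2).im : ℂ) = (ζ ^ 2 - ((starRingEnd ℂ) ζ) ^ 2) / (2 * Complex.I) := by
    rw [← map_pow, Complex.sub_conj]; have := Complex.I_ne_zero; field_simp; push_cast; ring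
  rw [Complex.ofReal_div, hD, hI]
  have := Complex.I_ne_zero
  simp only [Complex.ofReal_zero, mul_zero, Complex.exp_zero]
  generalize (starRingEnd ℂ) ζ = w at *
  field_simp
  simp only [Complex.I_sq]
  ring

lemma inv1 {ζ : ℂ} (hζ : 0 < ζ.im) (hz : (ζ ^ 2).im ≠ 0) (r : ℝ) :
    ∫ s : ℝ, Complex.exp (Complex.I * s * r) *
      ((s / ((s ^ 2 - (ζ ^ 2).re) ^ 2 + (ζ ^ 2).im ^ 2) : ℝ) : ℂ) =
     Complex.I * π * GG ζ r / (ζ ^ 2).im := by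
  set a := (ζ ^ 2).re
  set b := (ζ ^ 2).im
  have hb : (b : ℂ) ≠ 0 := by exact_mod_cast hz
  set H : ℝ → ℂ := fun s => ((s / ((s ^ 2 - a) ^ 2 + b ^ 2) : ℝ) : ℂ) with hH
  have hHint : Integrable H := (int1 (a := a) hz).ofReal
  have hF : FourierTransform.fourier (GG ζ) = fun w : ℝ => -2 * Complex.I * b *
        H (2 * π * w) := by
    ext w
    rw [Real.fourier_real_eq_integral_exp_smul]
    simp only [hH]
    rw [← GG_transform hζ]
    congr 1 with r
    rw [smul_eq_mul]
    congr 2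
    push_cast
    ring
  have hFi : Integrable (FourierTransform.fourier (GG ζ)) := by
    rw [hF]
    exact (hHint.comp_mul_left' (by positivity)).const_mul _
  have hc : Continuous (GG ζ) := by unfold GG; fun_prop
  have h := congrFun (hc.fourierInv_fourier_eq (GG_int hζ) hFi) r
  rw [Real.fourierInv_eq', hF] at h
  have h2 : ∀ v : ℝ, Complex.exp (((2 * π * ⟪v, r⟫_ℝ : ℝ) : ℂ) * Complex.I) •
      (-2 * Complex.I * b * H (2 * π * v)) =
      (-2 * Complex.I * b) * (fun s : ℝ => Complex.exp (Complex.I * s * r) * H s) ((2 * π) * v) := by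
    intro v
    simp only [smul_eq_mul]
    have : (((2 * π * ⟪v, r⟫_ℝ : ℝ) : ℂ) * Complex.I) = Complex.I * ((2 * π * v : ℝ) : ℂ) * r := by
      simp; ring
    rw [this]; ring
  simp_rw [h2] at h
  rw [integral_const_mul, Measure.integral_comp_mul_left
    (fun s : ℝ => Complex.exp (Complex.I * s * r) * H s), abs_of_pos (by positivity)] at h
  rw [← h, Complex.real_smul]
  change ∫ s : ℝ, Complex.exp (Complex.I * s * r) * H s = _
  generalize (∫ s : ℝ, Complex.exp (Complex.I * s * r) * H s) = K
  have := Complex.I_ne_zero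
  have hp : (π : ℂ) ≠ 0 := by exact_mod_cast Real.pi_ne_zero
  push_cast
  field_simp
  rw [Complex.I_sq]; ring

abbrev V2 := EuclideanSpace ℝ (Fin 2)

noncomputable def Phi (a b s : ℝ) : ℝ := π / |b| * (π / 2 - Real.arctan ((s ^ 2 - a) / |b|))

lemma Phi_deriv {a b : ℝ} (hb : b ≠ 0) (s : ℝ) :
    HasDerivAt (Phi a b) (-2 * π * (s / ((s ^ 2 - a) ^ 2 + b ^ 2))) s := by
  have h : HasDerivAt (fun s : ℝ => (s ^ 2 - a) / |b|) (2 * s / |b|) s := by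
    simpa using ((hasDerivAt_pow 2 s).sub_const a).div_const |b|
  have h2 := (h.arctan.const_sub (π / 2)).const_mul (π / |b|)
  convert! h2 using 1
  have hb' : |b| ≠ 0 := abs_ne_zero.mpr hb
  have := (den_pos (a := a) hb (s ^ 2)).ne'
  have e : 1 + ((s ^ 2 - a) / |b|) ^ 2 = ((s ^ 2 - a) ^ 2 + b ^ 2) / b ^ 2 := by
    rw [div_pow, sq_abs]; field_simp; ring
  have e2 : |b| * |b| = b ^ 2 := by rw [← pow_two, sq_abs]
  rw [e]
  field_simp
  rw [show |b| ^ 2 = b ^ 2 from sq_abs b]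

lemma radial2 {a b : ℝ} (hb : b ≠ 0) (s : ℝ) :
    ∫ v : V2, 1 / ((s ^ 2 + ‖v‖ ^ 2 - a) ^ 2 + b ^ 2) = Phi a b s := by
  have hb' : 0 < |b| := abs_pos.mpr hb
  have h := integral_fun_norm_addHaar (volume : Measure V2)
    (fun ρ : ℝ => 1 / ((s ^ 2 + ρ ^ 2 - a) ^ 2 + b ^ 2))
  rw [h]
  have hd : ∀ ρ ∈ Set.Ici (0:ℝ), HasDerivAt
      (fun ρ : ℝ => 1 / (2 * |b|) * Real.arctan ((s ^ 2 + ρ ^ 2 - a) / |b|))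
      (ρ * (1 / ((s ^ 2 + ρ ^ 2 - a) ^ 2 + b ^ 2))) ρ := by
    intro ρ _
    have h : HasDerivAt (fun ρ : ℝ => (s ^ 2 + ρ ^ 2 - a) / |b|) (2 * ρ / |b|) ρ := by
      simpa using (((hasDerivAt_pow 2 ρ).const_add (s ^ 2)).sub_const a).div_const |b|
    convert! h.arctan.const_mul (1 / (2 * |b|)) using 1
    have := (den_pos (a := a) hb (s ^ 2 + ρ ^ 2)).ne'
    have e : 1 + ((s ^ 2 + ρ ^ 2 - a) / |b|) ^ 2 = ((s ^ 2 + ρ ^ 2 - a) ^ 2 + b ^ 2) / b ^ 2 := by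
      rw [div_pow, sq_abs]; field_simp; ring
    rw [e]
    field_simp
    rw [show |b| ^ 2 = b ^ 2 from sq_abs b]
  have ht : Filter.Tendsto (fun ρ : ℝ => 1 / (2 * |b|) * Real.arctan ((s ^ 2 + ρ ^ 2 - a) / |b|))
      Filter.atTop (nhds (1 / (2 * |b|) * (π / 2))) := by
    refine Filter.Tendsto.const_mul _ ?_
    refine (Real.tendsto_arctan_atTop.mono_right nhdsWithin_le_nhds).comp ?_
    refine Filter.Tendsto.atTop_div_const hb' ?_
    refine Filter.tendsto_atTop_add_const_right _ _ ?_
    exact Filter.tendsto_atTop_add_const_left _ _ (Filter.tendsto_pow_atTop two_ne_zero)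
  have hnn : ∀ ρ ∈ Set.Ioi (0:ℝ), 0 ≤ ρ * (1 / ((s ^ 2 + ρ ^ 2 - a) ^ 2 + b ^ 2)) := by
    intro ρ hρ
    have := (den_pos (a := a) hb (s ^ 2 + ρ ^ 2))
    have h0 : 0 < ρ := hρ
    positivity
  have hi := integral_Ioi_of_hasDerivAt_of_nonneg' hd hnn ht
  have hdim : Module.finrank ℝ V2 = 2 := by simp
  rw [hdim]
  simp only [smul_eq_mul, nsmul_eq_mul, Nat.add_one_sub_one, pow_one]
  have hvol : (volume : Measure V2).real (Metric.ball 0 1) = π := by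
    rw [Measure.real, EuclideanSpace.volume_ball_fin_two]; simp [Real.pi_pos.le]
  rw [hi, hvol, Phi]
  simp
  field_simp

abbrev W3 := WithLp 2 (ℝ × V2)

lemma exists_iso (x : EuclideanSpace ℝ (Fin 3)) (hx : x ≠ 0) :
    ∃ A : W3 ≃ₗᵢ[ℝ] EuclideanSpace ℝ (Fin 3), x = ‖x‖ • A (WithLp.toLp 2 (1, 0)) := by
  have gen : ∀ {E : Type} [NormedAddCommGroup E] [InnerProductSpace ℝ E] [FiniteDimensional ℝ E]
      (_ : Module.finrank ℝ E = 3) (u : E) (_ : ‖u‖ = 1), ∃ b : OrthonormalBasis (Fin 3) ℝ E, b 0 = u := by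
    intro E _ _ _ hE u hu
    have ho : Orthonormal ℝ (Set.domRestrict ({0} : Set (Fin 3)) (fun _ => u)) := by
      constructor
      · intro i; exact hu
      · intro i j hij; exact absurd (Subsingleton.elim i j) hij
    obtain ⟨b, hb⟩ := ho.exists_orthonormalBasis_extension_of_card_eq (by simp [hE])
    exact ⟨b, hb 0 rfl⟩
  obtain ⟨b, hb⟩ := gen (by simp) ((‖x‖)⁻¹ • x) (by
    rw [norm_smul, norm_inv, norm_norm, inv_mul_cancel₀ (norm_ne_zero_iff.mpr hx)])
  have hdim : Module.finrank ℝ W3 = 3 := by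
    rw [LinearEquiv.finrank_eq (WithLp.linearEquiv 2 ℝ (ℝ × V2)), Module.finrank_prod]; simp
  obtain ⟨b', hb'⟩ := gen (E := W3) hdim (WithLp.toLp 2 (1, 0)) (by
    simp)
  refine ⟨b'.equiv b (Equiv.refl _), ?_⟩
  rw [← hb', OrthonormalBasis.equiv_apply_basis]
  simp [hb, smul_smul, norm_ne_zero_iff.mpr hx]

lemma cyl {a b : ℝ} (hb : b ≠ 0) (x : EuclideanSpace ℝ (Fin 3)) (hx : x ≠ 0) :
    Integrable (Phi a b) ∧
    ∫ k : EuclideanSpace ℝ (Fin 3), Complex.exp (Complex.I * ((⟪k, x⟫_ℝ : ℝ) : ℂ)) *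
      ((1 / ((‖k‖ ^ 2 - a) ^ 2 + b ^ 2) : ℝ) : ℂ) =
    ∫ s : ℝ, Complex.exp (Complex.I * s * ‖x‖) * (Phi a b s : ℂ) := by
  obtain ⟨A, hA⟩ := exists_iso x hx
  have hmp : MeasurePreserving (fun p : ℝ × V2 => A (WithLp.toLp 2 p)) volume volume :=
    A.measurePreserving.comp (WithLp.volume_preserving_toLp ℝ V2)
  have hme : MeasurableEmbedding (fun p : ℝ × V2 => A (WithLp.toLp 2 p)) :=
    A.toHomeomorph.measurableEmbedding.comp (MeasurableEquiv.toLp 2 (ℝ × V2)).measurableEmbedding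
  have hn : ∀ p : ℝ × V2, ‖A (WithLp.toLp 2 p)‖ ^ 2 = p.1 ^ 2 + ‖p.2‖ ^ 2 := by
    intro p
    rw [A.norm_map, WithLp.prod_norm_sq_eq_of_L2]; simp
  have hin : ∀ p : ℝ × V2, ⟪A (WithLp.toLp 2 p), x⟫_ℝ = p.1 * ‖x‖ := by
    intro p
    conv_lhs => rw [hA]
    rw [inner_smul_right, A.inner_map_map, WithLp.prod_inner_apply]
    simp [mul_comm]
  have hI : Integrable (fun p : ℝ × V2 => 1 / ((p.1 ^ 2 + ‖p.2‖ ^ 2 - a) ^ 2 + b ^ 2)) := by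
    have := (hmp.integrable_comp_emb hme).mpr (int3 (a := a) hb)
    refine this.congr (Filter.Eventually.of_forall fun p => ?_)
    simp only [Function.comp, hn]
  constructor
  · have := Integrable.integral_prod_left (f := fun p : ℝ × V2 => 1 / ((p.1 ^ 2 + ‖p.2‖ ^ 2 - a) ^ 2 + b ^ 2)) hI
    simpa only [radial2 hb] using this
  · rw [← hmp.integral_comp hme]
    simp only [hn, hin]
    rw [Measure.volume_eq_prod, integral_prod]
    · congr 1 with s
      simp only
      rw [integral_const_mul, integral_complex_ofReal, radial2 hb]
      congr 2
      push_cast; ring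
    · rw [← Measure.volume_eq_prod]
      refine hI.norm.mono' ?_ (Filter.Eventually.of_forall fun p => ?_)
      · apply AEStronglyMeasurable.mul
        · apply Continuous.aestronglyMeasurable; fun_prop
        · exact Complex.continuous_ofReal.comp_aestronglyMeasurable hI.aestronglyMeasurable
      · rw [norm_mul, Complex.norm_exp, Complex.norm_real]; simp

lemma int_cexp {α : Type*} [MeasurableSpace α] {μ : Measure α} {f : α → ℝ} (hf : Integrable f μ)
    {g : α → ℝ} (hg : Measurable g) :
    Integrable (fun k => Complex.exp (Complex.I * (g k : ℂ)) * (f k : ℂ)) μ := by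
  refine hf.norm.mono' ?_ (Filter.Eventually.of_forall fun p => ?_)
  · apply AEStronglyMeasurable.mul
    · apply Measurable.aestronglyMeasurable; fun_prop
    · exact Complex.continuous_ofReal.comp_aestronglyMeasurable hf.aestronglyMeasurable
  · rw [norm_mul, Complex.norm_exp, Complex.norm_real]; simp

lemma ft3 {ζ : ℂ} (hζ : 0 < ζ.im) (hz : (ζ ^ 2).im ≠ 0)
    (x : EuclideanSpace ℝ (Fin 3)) (hx : x ≠ 0) :
    ∫ k : EuclideanSpace ℝ (Fin 3), Complex.exp (Complex.I * ((⟪k, x⟫_ℝ : ℝ) : ℂ)) *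
      ((1 / ((‖k‖ ^ 2 - (ζ ^ 2).re) ^ 2 + (ζ ^ 2).im ^ 2) : ℝ) : ℂ) =
    2 * π ^ 2 / (ζ ^ 2).im * (GG ζ ‖x‖ / ‖x‖) := by
  obtain ⟨hPhi, h⟩ := cyl (a := (ζ ^ 2).re) hz x hx
  rw [h]
  have h1 := inv1 hζ hz ‖x‖
  set a := (ζ ^ 2).re
  set b := (ζ ^ 2).im
  set r := ‖x‖ with hr
  have hr0 : (r : ℂ) ≠ 0 := by simpa [hr] using hx
  have e : ∀ s : ℝ, Complex.exp (Complex.I * s * r) = Complex.exp (Complex.I * ((s * r : ℝ) : ℂ)) := by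
    intro s; congr 1; push_cast; ring
  have ip := integral_mul_deriv_eq_deriv_mul_of_integrable
    (u := fun s : ℝ => Complex.exp (Complex.I * s * r))
    (u' := fun s : ℝ => Complex.I * r * Complex.exp (Complex.I * s * r))
    (v := fun s : ℝ => (Phi a b s : ℂ))
    (v' := fun s : ℝ => ((-2 * π * (s / ((s ^ 2 - a) ^ 2 + b ^ 2)) : ℝ) : ℂ))
    (fun s _ => by
      have h0 : HasDerivAt (fun s : ℝ => Complex.I * s * r) (Complex.I * r) s := by
        have := ((Complex.ofRealCLM.hasDerivAt (x := s)).const_mul Complex.I).mul_const (r : ℂ)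
        simpa using this
      have := h0.cexp
      rwa [mul_comm] at this)
    (fun s _ => (Phi_deriv hz s).ofReal_comp)
    (by
      have := int_cexp ((int1 (a := a) hz).const_mul (-2 * π)) (g := fun s : ℝ => s * r) (by fun_prop)
      refine this.congr (Filter.Eventually.of_forall fun s => ?_)
      simp only [Pi.mul_apply, e])
    (by
      have := (int_cexp hPhi (g := fun s : ℝ => s * r) (by fun_prop)).const_mul (Complex.I * r)
      refine this.congr (Filter.Eventually.of_forall fun s => ?_)
      simp only [Pi.mul_apply, e]; ring)
    (by
      have := int_cexp hPhi (g := fun s : ℝ => s * r) (by fun_prop)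
      refine this.congr (Filter.Eventually.of_forall fun s => ?_)
      simp only [Pi.mul_apply, e])
  have l : ∀ s : ℝ, Complex.exp (Complex.I * s * r) *
      ((-2 * π * (s / ((s ^ 2 - a) ^ 2 + b ^ 2)) : ℝ) : ℂ) = (-2 * π) *
      (Complex.exp (Complex.I * s * r) * ((s / ((s ^ 2 - a) ^ 2 + b ^ 2) : ℝ) : ℂ)) := by
    intro s; push_cast; ring
  simp_rw [l, mul_assoc (Complex.I * (r : ℂ))] at ip
  rw [integral_const_mul, integral_const_mul, h1] at ip
  generalize (∫ s : ℝ, Complex.exp (Complex.I * s * r) * (Phi a b s : ℂ)) = K at *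
  have hb : (b : ℂ) ≠ 0 := by exact_mod_cast hz
  have hI := Complex.I_ne_zero
  have : Complex.I * (r * K) = Complex.I * (2 * π ^ 2 * GG ζ r / b) := by
    linear_combination ip
  have := mul_left_cancel₀ hI this
  field_simp
  field_simp at this
  linear_combination this

lemma ft3_zero {ζ : ℂ} (hζ : 0 < ζ.im) (hz : (ζ ^ 2).im ≠ 0) :
    ∫ k : EuclideanSpace ℝ (Fin 3),
      ((1 / ((‖k‖ ^ 2 - (ζ ^ 2).re) ^ 2 + (ζ ^ 2).im ^ 2) : ℝ) : ℂ) =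
    2 * π ^ 2 / (ζ ^ 2).im * ζ.re := by
  have hft := ft3 hζ hz
  have h3 := int3 (a := (ζ ^ 2).re) hz
  set f : EuclideanSpace ℝ (Fin 3) → ℝ :=
    fun k => 1 / ((‖k‖ ^ 2 - (ζ ^ 2).re) ^ 2 + (ζ ^ 2).im ^ 2) with hf
  set e : EuclideanSpace ℝ (Fin 3) := EuclideanSpace.single 0 1
  have he : ‖e‖ = 1 := by simp [e]
  have he0 : e ≠ 0 := by intro h; simp [h] at he
  let J : ℝ → ℂ := fun t => ∫ k, Complex.exp (Complex.I * ((⟪k, t • e⟫_ℝ : ℝ) : ℂ)) * (f k : ℂ)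
  have hJ : Continuous J := by
    refine continuous_of_dominated (bound := fun k => ‖f k‖) ?_ ?_ h3.norm ?_
    · intro t
      exact (int_cexp h3 (g := fun k => ⟪k, t • e⟫_ℝ) (by fun_prop)).aestronglyMeasurable
    · intro t
      refine Filter.Eventually.of_forall fun k => ?_
      rw [norm_mul, Complex.norm_exp, Complex.norm_real]; simp
    · refine Filter.Eventually.of_forall fun k => ?_
      fun_prop
  have hJ0 : J 0 = ∫ k, (f k : ℂ) := by simp [J]
  change ∫ k, (f k : ℂ) = _
  rw [← hJ0]
  have l1 : Filter.Tendsto J (nhdsWithin 0 (Set.Ioi 0)) (nhds (J 0)) :=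
    hJ.continuousAt.tendsto.mono_left nhdsWithin_le_nhds
  have hd : HasDerivAt (fun t : ℝ => Real.exp (-ζ.im * t) * Real.sin (ζ.re * t)) ζ.re 0 := by
    have h1 : HasDerivAt (fun t : ℝ => -ζ.im * t) (-ζ.im) 0 := by
      simpa using (hasDerivAt_id (0:ℝ)).const_mul (-ζ.im)
    have h2 : HasDerivAt (fun t : ℝ => ζ.re * t) (ζ.re) 0 := by
      simpa using (hasDerivAt_id (0:ℝ)).const_mul (ζ.re)
    convert! h1.exp.mul h2.sin using 1
    simp
  have l2 := hd.tendsto_slope_zero_right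
  have l3 : Filter.Tendsto J (nhdsWithin 0 (Set.Ioi 0)) (nhds (2 * π ^ 2 / (ζ ^ 2).im * ζ.re)) := by
    have := ((Complex.continuous_ofReal.tendsto _).comp l2).const_mul (2 * (π:ℂ) ^ 2 / (ζ ^ 2).im)
    refine this.congr' ?_
    filter_upwards [self_mem_nhdsWithin] with t ht
    have ht : 0 < t := ht
    have := hft (t • e) (smul_ne_zero ht.ne' he0)
    simp only [J]
    rw [this, norm_smul, he, mul_one, Real.norm_of_nonneg ht.le, GG, abs_of_pos ht]
    simp [div_eq_mul_inv, mul_comm, mul_left_comm]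
  exact tendsto_nhds_unique l1 l3

/-- the matrix entries -/
noncomputable def qq (x : ℤ → EuclideanSpace ℝ (Fin 3)) (ζ : ℂ) (p : ℤ × ℤ) : ℂ :=
  if p.1 = p.2 then Complex.I * ζ / (4 * (π : ℂ)) else
          Complex.exp (Complex.I * ζ * (‖x p.1 - x p.2‖ : ℂ)) /
            ((4 * π * ‖x p.1 - x p.2‖ : ℝ) : ℂ)

lemma qq_swap (x : ℤ → EuclideanSpace ℝ (Fin 3)) (ζ : ℂ) (p : ℤ × ℤ) :
    qq x ζ p.swap = qq x ζ p := by
  simp only [qq, Prod.fst_swap, Prod.snd_swap, norm_sub_rev (x p.2), eq_comm (a := p.2)]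

lemma qq_im (x : ℤ → EuclideanSpace ℝ (Fin 3)) (hx : Function.Injective x) {ζ : ℂ}
    (hζ : 0 < ζ.im) (hz : (ζ ^ 2).im ≠ 0) (p : ℤ × ℤ) :
    ((qq x ζ p).im : ℂ) = (ζ ^ 2).im / (2 * π) ^ 3 *
      ∫ k : EuclideanSpace ℝ (Fin 3),
       Complex.exp (Complex.I * ((⟪k, x p.1 - x p.2⟫_ℝ : ℝ) : ℂ)) *
      ((1 / ((‖k‖ ^ 2 - (ζ ^ 2).re) ^ 2 + (ζ ^ 2).im ^ 2) : ℝ) : ℂ) := by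
  have hb : ((ζ ^ 2).im : ℂ) ≠ 0 := by exact_mod_cast hz
  have hp : (π : ℂ) ≠ 0 := by exact_mod_cast Real.pi_ne_zero
  by_cases h : p.1 = p.2
  · rw [h]
    simp only [sub_self, inner_zero_right, Complex.ofReal_zero, mul_zero, Complex.exp_zero, one_mul]
    rw [ft3_zero hζ hz, qq, if_pos h]
    have : (Complex.I * ζ / (4 * (π : ℂ))).im = ζ.re / (4 * π) := by
      rw [show (4 * (π : ℂ)) = ((4 * π : ℝ) : ℂ) by push_cast; rfl, Complex.div_ofReal_im]; simp
    rw [this]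
    push_cast
    field_simp
    norm_num
  · have hne : x p.1 - x p.2 ≠ 0 := sub_ne_zero.mpr fun h' => h (hx h')
    rw [ft3 hζ hz _ hne, qq, if_neg h, Complex.div_ofReal_im, GG]
    have hr : ((‖x p.1 - x p.2‖ : ℝ) : ℂ) ≠ 0 := by simpa using hne
    have : (Complex.exp (Complex.I * ζ * (‖x p.1 - x p.2‖ : ℂ))).im =
        Real.exp (-ζ.im * |‖x p.1 - x p.2‖|) * Real.sin (ζ.re * ‖x p.1 - x p.2‖) := by
      rw [Complex.exp_im]; simp
    rw [this]
    generalize Real.exp (-ζ.im * |‖x p.1 - x p.2‖|) * Real.sin (ζ.re * ‖x p.1 - x p.2‖) = K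
    push_cast
    field_simp
    norm_num

lemma main_summable (x : ℤ → EuclideanSpace ℝ (Fin 3))
    (c : ℤ → ℂ) (hc : Summable fun n : ℤ => ‖c n‖)
    (hcx : Summable fun p : ℤ × ℤ =>
      if p.1 = p.2 then (0 : ℝ) else ‖c p.1‖ * ‖c p.2‖ / ‖x p.1 - x p.2‖)
    {ζ : ℂ} (hζ : 0 < ζ.im) :
    Summable fun p : ℤ × ℤ => (starRingEnd ℂ) (c p.1) * c p.2 * qq x ζ p := by
  have hcc : Summable fun p : ℤ × ℤ => ‖c p.1‖ * ‖c p.2‖ :=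
    hc.mul_of_nonneg hc (fun _ => norm_nonneg _) (fun _ => norm_nonneg _)
  refine Summable.of_norm_bounded
    ((hcc.mul_right (‖ζ‖ / (4 * π))).add (hcx.mul_right (1 / (4 * π)))) fun p => ?_
  rw [norm_mul, norm_mul, RCLike.norm_conj, qq]
  have hpi := Real.pi_pos
  split_ifs with h
  · simp [abs_of_pos hpi]
  · rw [norm_div, Complex.norm_real, Complex.norm_exp]
    have h1 : Real.exp (Complex.I * ζ * (‖x p.1 - x p.2‖ : ℂ)).re ≤ 1 := by
      rw [Real.exp_le_one_iff]; simp; positivity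
    rw [Real.norm_of_nonneg (by positivity)]
    have h2 : 0 ≤ ‖c p.1‖ * ‖c p.2‖ * (‖ζ‖ / (4 * π)) := by positivity
    have h3 : ‖c p.1‖ * ‖c p.2‖ * (Real.exp (Complex.I * ζ * (‖x p.1 - x p.2‖ : ℂ)).re / (4 * π * ‖x p.1 - x p.2‖))
      ≤ ‖c p.1‖ * ‖c p.2‖ * (1 / (4 * π * ‖x p.1 - x p.2‖)) := by gcongr
    have h4 : ‖c p.1‖ * ‖c p.2‖ * (1 / (4 * π * ‖x p.1 - x p.2‖)) =
      ‖c p.1‖ * ‖c p.2‖ / ‖x p.1 - x p.2‖ * (1 / (4 * π)) := by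
      simp only [div_eq_mul_inv, mul_inv]; ring
    linarith

lemma im_sum {c : ℤ → ℂ} {q : ℤ × ℤ → ℂ} (hq : ∀ p, q p.swap = q p)
    (hs : Summable fun p : ℤ × ℤ => (starRingEnd ℂ) (c p.1) * c p.2 * q p) :
    (((∑' p : ℤ × ℤ, (starRingEnd ℂ) (c p.1) * c p.2 * q p).im : ℝ) : ℂ) =
      ∑' p : ℤ × ℤ, (starRingEnd ℂ) (c p.1) * c p.2 * (q p).im := by
  set F := ∑' p : ℤ × ℤ, (starRingEnd ℂ) (c p.1) * c p.2 * q p with hF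
  have h1 : HasSum (fun p : ℤ × ℤ => (starRingEnd ℂ) (c p.1) * c p.2 * q p) F := hs.hasSum
  have h2 : HasSum (fun p : ℤ × ℤ => (starRingEnd ℂ) (c p.1) * c p.2 * (starRingEnd ℂ) (q p))
      ((starRingEnd ℂ) F) := by
    have := h1.star
    have := (Equiv.prodComm ℤ ℤ).hasSum_iff.mpr this
    have hfun : (fun p : ℤ × ℤ => (starRingEnd ℂ) (c p.1) * c p.2 * (starRingEnd ℂ) (q p)) =
        (fun p : ℤ × ℤ => star ((starRingEnd ℂ) (c p.1) * c p.2 * q p)) ∘ Equiv.prodComm ℤ ℤ := by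
      ext p
      have := hq p
      simp only [Function.comp, Equiv.prodComm_apply, this, Prod.fst_swap, Prod.snd_swap]
      change _ = (starRingEnd ℂ) _
      simp only [map_mul, Complex.conj_conj]
      ring
    rw [hfun]
    exact this
  have h3 := (h1.sub h2).mul_right (1 / (2 * Complex.I))
  have hI := Complex.I_ne_zero
  have e : ∀ w : ℂ, (w.im : ℂ) = (w - (starRingEnd ℂ) w) * (1 / (2 * Complex.I)) := by
    intro w; rw [Complex.sub_conj]; push_cast; field_simp
  rw [e F, ← h3.tsum_eq]
  congr 1 with p
  rw [e (q p)]; ring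

/-- Positivity identity (2.27), the Nevanlinna property of the matrix
function `Q(z)`: with `q_{mn}` the Helmholtz Green's function values
(`q_{mm} = iζ/4π`) and `F = ∑_{m,n} conj(c_m)·c_n·q_{mn}`,
`Im F / Im z = (2π)⁻³ ∫ |∑_n c_n e^{-i⟨k,x_n⟩}|²/((|k|²-Re z)²+(Im z)²) dk ≥ 0`. -/
theorem Q_matrix_nevanlinna
    (x : ℤ → EuclideanSpace ℝ (Fin 3)) (hx : Function.Injective x)
    (c : ℤ → ℂ) (hc : Summable fun n : ℤ => ‖c n‖)
    (hcx : Summable fun p : ℤ × ℤ =>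
      if p.1 = p.2 then (0 : ℝ) else ‖c p.1‖ * ‖c p.2‖ / ‖x p.1 - x p.2‖)
    (z : ℂ) (hz : z.im ≠ 0) (ζ : ℂ) (hζsq : ζ ^ 2 = z) (hζ : 0 < ζ.im)
    (F : ℂ)
    (hF : F = ∑' p : ℤ × ℤ,
      (starRingEnd ℂ) (c p.1) * c p.2 *
        (if p.1 = p.2 then Complex.I * ζ / (4 * (π : ℂ)) else
          Complex.exp (Complex.I * ζ * (‖x p.1 - x p.2‖ : ℂ)) /
            ((4 * π * ‖x p.1 - x p.2‖ : ℝ) : ℂ))) :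
    F.im / z.im =
      (1 / (2 * π) ^ 3) *
        ∫ k : EuclideanSpace ℝ (Fin 3),
          ‖∑' n : ℤ, c n * Complex.exp (-Complex.I * ((⟪k, x n⟫_ℝ : ℝ) : ℂ))‖ ^ 2 /
            ((‖k‖ ^ 2 - z.re) ^ 2 + z.im ^ 2) ∧
      0 ≤ F.im / z.im := by
  subst hζsq
  have main : F.im / (ζ ^ 2).im =
      (1 / (2 * π) ^ 3) *
        ∫ k : EuclideanSpace ℝ (Fin 3),
          ‖∑' n : ℤ, c n * Complex.exp (-Complex.I * ((⟪k, x n⟫_ℝ : ℝ) : ℂ))‖ ^ 2 /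
            ((‖k‖ ^ 2 - (ζ ^ 2).re) ^ 2 + (ζ ^ 2).im ^ 2) := by
    have hF' : F = ∑' p : ℤ × ℤ, (starRingEnd ℂ) (c p.1) * c p.2 * qq x ζ p := hF
    have him := im_sum (qq_swap x ζ) (main_summable x c hc hcx hζ)
    rw [← hF'] at him
    simp_rw [qq_im x hx hζ hz] at him
    have h3 := int3 (a := (ζ ^ 2).re) hz
    set f : EuclideanSpace ℝ (Fin 3) → ℝ :=
      fun k => 1 / ((‖k‖ ^ 2 - (ζ ^ 2).re) ^ 2 + (ζ ^ 2).im ^ 2) with hf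
    set b := (ζ ^ 2).im
    have hb : (b : ℂ) ≠ 0 := by exact_mod_cast hz
    let T : ℤ × ℤ → EuclideanSpace ℝ (Fin 3) → ℂ := fun p k =>
      (starRingEnd ℂ) (c p.1) * c p.2 *
        (Complex.exp (Complex.I * ((⟪k, x p.1 - x p.2⟫_ℝ : ℝ) : ℂ)) * (f k : ℂ))
    have hT : ∀ p, Integrable (T p) := fun p =>
      (int_cexp h3 (g := fun k => ⟪k, x p.1 - x p.2⟫_ℝ) (by fun_prop)).const_mul _
    have hcc : Summable fun p : ℤ × ℤ => ‖c p.1‖ * ‖c p.2‖ :=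
      hc.mul_of_nonneg hc (fun _ => norm_nonneg _) (fun _ => norm_nonneg _)
    have hTs : Summable fun p => ∫ k, ‖T p k‖ := by
      refine (hcc.mul_right (∫ k, ‖f k‖)).congr fun p => ?_
      rw [← integral_const_mul]
      congr 1 with k
      simp only [T]
      rw [norm_mul, norm_mul, norm_mul, RCLike.norm_conj, Complex.norm_exp, Complex.norm_real]
      simp
    have hsw := integral_tsum_of_summable_integral_norm hT hTs
    have hpt : ∀ k, ∑' p, T p k =
        ((‖∑' n : ℤ, c n * Complex.exp (-Complex.I * ((⟪k, x n⟫_ℝ : ℝ) : ℂ))‖ ^ 2 /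
            ((‖k‖ ^ 2 - (ζ ^ 2).re) ^ 2 + b ^ 2) : ℝ) : ℂ) := by
      intro k
      set g : ℤ → ℂ := fun n => c n * Complex.exp (-Complex.I * ((⟪k, x n⟫_ℝ : ℝ) : ℂ)) with hg
      have hgn : Summable fun n => ‖g n‖ := by
        refine hc.congr fun n => ?_
        simp only [hg]; rw [norm_mul, Complex.norm_exp]; simp
      have hgn' : Summable fun n => ‖(starRingEnd ℂ) (g n)‖ := by
        simpa only [RCLike.norm_conj] using hgn
      rw [div_eq_mul_one_div, Complex.ofReal_mul, Complex.ofReal_pow, ← Complex.conj_mul',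
        Complex.conj_tsum, tsum_mul_tsum_of_summable_norm hgn' hgn, ← tsum_mul_right]
      congr 1 with p
      simp only [T, hg, hf, map_mul, ← Complex.exp_conj, map_neg, Complex.conj_I, Complex.conj_ofReal]
      rw [inner_sub_right]
      have : Complex.exp (Complex.I * ((⟪k, x p.1⟫_ℝ - ⟪k, x p.2⟫_ℝ : ℝ) : ℂ)) =
        Complex.exp (- -Complex.I * ((⟪k, x p.1⟫_ℝ : ℝ) : ℂ)) *
        Complex.exp (-Complex.I * ((⟪k, x p.2⟫_ℝ : ℝ) : ℂ)) := by
        rw [← Complex.exp_add]; congr 1; push_cast; ring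
      rw [this]; ring
    simp_rw [hpt] at hsw
    rw [integral_complex_ofReal] at hsw
    have hfin : ((F.im : ℝ) : ℂ) = b / (2 * π) ^ 3 * ∑' p, ∫ k, T p k := by
      rw [him, ← tsum_mul_left]
      congr 1 with p
      simp only [T]
      rw [integral_const_mul]; ring
    rw [hsw] at hfin
    have : F.im = b / (2 * π) ^ 3 * ∫ k : EuclideanSpace ℝ (Fin 3),
          ‖∑' n : ℤ, c n * Complex.exp (-Complex.I * ((⟪k, x n⟫_ℝ : ℝ) : ℂ))‖ ^ 2 /
            ((‖k‖ ^ 2 - (ζ ^ 2).re) ^ 2 + b ^ 2) := by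
      exact_mod_cast hfin
    rw [this]
    field_simp
  refine ⟨main, ?_⟩
  rw [main]
  refine mul_nonneg (by positivity) (integral_nonneg fun k => ?_)
  positivity
end
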